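/- arXiv:1912.11086 — 2 statements merged into one kernel-verified Lean document; each statement's English description precedes it below -/
import Mathlib

section
/- Let Ω ⊆ ℝ^d be a bounded Lipschitz domain such that cl(Ω) is homeomorphic to the closed unit ball of ℝ^d. Let V ⊆ ℝ^d be an open set containing cl(Ω) and let y : V → ℝ^d be continuously differentiable, such that the restriction y|_{∂Ω} is injective and det Dy(x) ≠ 0 for every x ∈ ∂Ω. Then y|_{∂Ω} admits a homeomorphic extension to cl(Ω): there exists a continuous injective map h : cl(Ω) → ℝ^d with h = y on ∂Ω. -/
/-- The open cylinder at `p` in direction `ν` with radius/height `ε`: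
`{p + x' + tν : x' ⊥ ν, |x'| < ε, |t| < ε}`. -/
def LipCylinder {d : ℕ} (p ν : EuclideanSpace ℝ (Fin d)) (ε : ℝ) :
    Set (EuclideanSpace ℝ (Fin d)) :=
  {q | ∃ x' ∈ (ℝ ∙ ν)ᗮ, ∃ t : ℝ, ‖x'‖ < ε ∧ |t| < ε ∧ q = p + x' + t • ν}

/-- `Ω ⊆ ℝ^d` is a (strong) bounded Lipschitz domain: it is open, connected, bounded,
and near every boundary point the boundary is the graph of a Lipschitz function,
with `Ω` lying locally below the graph. -/
def IsLipschitzDomain {d : ℕ} (Ω : Set (EuclideanSpace ℝ (Fin d))) : Prop :=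
  IsOpen Ω ∧ IsConnected Ω ∧ Bornology.IsBounded Ω ∧
    ∀ p ∈ frontier Ω,
      ∃ (ε : ℝ) (ν : EuclideanSpace ℝ (Fin d))
        (g : EuclideanSpace ℝ (Fin d) → ℝ) (L : NNReal),
        0 < ε ∧ ‖ν‖ = 1 ∧ g 0 = 0 ∧
        LipschitzOnWith L g {x' | x' ∈ (ℝ ∙ ν)ᗮ ∧ ‖x'‖ < ε} ∧
        (∀ x' ∈ (ℝ ∙ ν)ᗮ, ‖x'‖ < ε → |g x'| < ε) ∧
        Ω ∩ LipCylinder p ν ε =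
          {q | ∃ x' ∈ (ℝ ∙ ν)ᗮ, ∃ t : ℝ, ‖x'‖ < ε ∧ -ε < t ∧ t < g x' ∧ q = p + x' + t • ν} ∧
        frontier Ω ∩ LipCylinder p ν ε =
          {q | ∃ x' ∈ (ℝ ∙ ν)ᗮ, ‖x'‖ < ε ∧ q = p + x' + g x' • ν}

section
open Set Filter Topology Metric MeasureTheory

section InvarianceOfDomain
variable {E : Type*} [NormedAddCommGroup E] [InnerProductSpace ℝ E] [FiniteDimensional ℝ E]

theorem exists_weights_det_one_add (v : Fin (Module.finrank ℝ E + 1) → ℝ)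
    (hv : Function.Injective v) :
    ∃ w : Fin (Module.finrank ℝ E + 1) → ℝ, ∀ A : E →L[ℝ] E,
      (1 + A).det = ∑ i, w i * (1 + v i • A).det := by
  refine ⟨fun i => (Lagrange.basis Finset.univ v i).eval 1, fun A => ?_⟩
  let b := Module.finBasis ℝ E
  let M := LinearMap.toMatrix b b (A : E →ₗ[ℝ] E)
  have hdet : ∀ t : ℝ, (1 + t • A).det = (1 + t • M).det := by
    intro t
    rw [ContinuousLinearMap.det, ← LinearMap.det_toMatrix b]
    congr 1
    ext i j
    simp [M, LinearMap.toMatrix_apply, Matrix.one_apply, Finsupp.single_apply, eq_comm]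
  let p : Polynomial ℝ :=
    (((Polynomial.X : Polynomial ℝ) • M.map Polynomial.C +
      (1 : Matrix _ _ ℝ).map Polynomial.C).det)
  have hp : ∀ t, p.eval t = (1 + t • A).det := by
    intro t
    rw [hdet, ← Polynomial.coe_evalRingHom, RingHom.map_det]
    congr 1
    ext i j
    simp only [RingHom.mapMatrix_apply, Matrix.map_apply, Matrix.add_apply, Matrix.smul_apply,
      smul_eq_mul, Matrix.one_apply, map_add, Polynomial.coe_evalRingHom, Polynomial.eval_C]
    split_ifs <;> simp [add_comm, mul_comm t]
  have hdeg : p.degree < (Finset.univ : Finset (Fin (Module.finrank ℝ E + 1))).card := by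
    refine (Polynomial.degree_le_of_natDegree_le
      (Polynomial.natDegree_det_X_add_C_le M 1)).trans_lt ?_
    simp only [Fintype.card_fin, Finset.card_univ]
    exact_mod_cast Nat.lt_succ_self _
  have := congrArg (Polynomial.eval 1) (Lagrange.eq_interpolate (v := v) hv.injOn hdeg)
  rw [hp, one_smul] at this
  rw [this, Lagrange.interpolate_apply, Polynomial.eval_finsetSum]
  refine Finset.sum_congr rfl fun i _ => ?_
  rw [Polynomial.eval_mul, Polynomial.eval_C, hp, mul_comm]

theorem one_add_det_pos {A : E →L[ℝ] E} (hA : ‖A‖ < 1) : 0 < (1 + A).det := by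
  have hne : ∀ B : E →L[ℝ] E, ‖B‖ < 1 → (1 + B).det ≠ 0 := by
    intro B hB h0
    obtain ⟨x, hx, hx0⟩ := (Submodule.ne_bot_iff _).1 (LinearMap.bot_lt_ker_of_det_eq_zero h0).ne'
    have h1 : x + B x = 0 := by simpa using hx
    have h2 : ‖x‖ ≤ ‖B‖ * ‖x‖ := by
      calc ‖x‖ = ‖B x‖ := by rw [← norm_neg, ← eq_neg_of_add_eq_zero_right h1]
        _ ≤ _ := B.le_opNorm x
    nlinarith [norm_pos_iff.2 hx0]
  have hc : ContinuousOn (fun s : ℝ => (1 + s • A).det) (Icc 0 1) := by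
    have : Continuous fun B : E →L[ℝ] E => B.det := ContinuousLinearMap.continuous_det
    exact (this.comp (by fun_prop)).continuousOn
  by_contra hneg
  have h1 : (0 : ℝ) ∈ Icc ((1 + (1:ℝ) • A).det) ((1 + (0:ℝ) • A).det) := by
    constructor
    · simpa using not_lt.mp hneg
    · simp [ContinuousLinearMap.det]
  obtain ⟨s, hs, hs0⟩ := intermediate_value_Icc' zero_le_one hc h1
  refine hne (s • A) ?_ hs0
  rw [norm_smul, Real.norm_of_nonneg hs.1]
  nlinarith [norm_nonneg A, hs.1, hs.2]

/-- The radial retraction of `E` onto the closed ball of radius `R`. -/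
noncomputable def ballRetraction (R : ℝ) (x : E) : E := (R / max R ‖x‖) • x

theorem ballRetraction_of_mem {R : ℝ} (hR : 0 < R) {x : E} (hx : ‖x‖ ≤ R) :
    ballRetraction R x = x := by
  rw [ballRetraction, max_eq_left hx, div_self hR.ne', one_smul]

theorem norm_ballRetraction_of_le {R : ℝ} (hR : 0 < R) {x : E} (hx : R ≤ ‖x‖) :
    ‖ballRetraction R x‖ = R := by
  have : 0 < ‖x‖ := hR.trans_le hx
  rw [ballRetraction, max_eq_right hx, norm_smul, Real.norm_of_nonneg (by positivity)]
  field_simp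

theorem norm_ballRetraction_le {R : ℝ} (hR : 0 < R) (x : E) : ‖ballRetraction R x‖ ≤ R := by
  rcases le_total ‖x‖ R with h | h
  · rwa [ballRetraction_of_mem hR h]
  · exact (norm_ballRetraction_of_le hR h).le

theorem norm_ballRetraction_sub_le {R : ℝ} (hR : 0 < R) (x y : E) :
    ‖ballRetraction R x - ballRetraction R y‖ ≤ 2 * ‖x - y‖ := by
  set a := max R ‖x‖ with ha
  set b := max R ‖y‖ with hb
  have ha0 : 0 < a := lt_max_of_lt_left hR
  have hb0 : 0 < b := lt_max_of_lt_left hR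
  have e : ballRetraction R x - ballRetraction R y =
      (R / a) • (x - y) + ((R / a) * ((b - a) / b)) • y := by
    rw [ballRetraction, ballRetraction, ← ha, ← hb, smul_sub, sub_add, ← sub_smul]
    congr 2
    field_simp
    ring
  have hRa : R / a ≤ 1 := (div_le_one ha0).2 (le_max_left _ _)
  have hRa0 : 0 ≤ R / a := by positivity
  have hab : |b - a| ≤ ‖x - y‖ := by
    rw [ha, hb, abs_sub_comm, max_comm, max_comm R]
    exact (abs_max_sub_max_le_abs _ _ _).trans (abs_norm_sub_norm_le x y)
  rw [e]
  refine (norm_add_le _ _).trans ?_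
  rw [norm_smul, norm_smul, Real.norm_of_nonneg hRa0, norm_mul, Real.norm_of_nonneg hRa0,
    norm_div, Real.norm_of_nonneg hb0.le, Real.norm_eq_abs]
  have h1 : |b - a| / b * ‖y‖ ≤ |b - a| := by
    rw [div_mul_eq_mul_div, div_le_iff₀ hb0]
    exact mul_le_mul_of_nonneg_left (le_max_right _ _) (abs_nonneg _)
  have h2 : R / a * (|b - a| / b) * ‖y‖ ≤ 1 * |b - a| := by
    rw [mul_assoc]
    exact mul_le_mul hRa h1 (by positivity) zero_le_one
  have h3 : R / a * ‖x - y‖ ≤ 1 * ‖x - y‖ := mul_le_mul_of_nonneg_right hRa (norm_nonneg _)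
  linarith


theorem not_exists_contDiff_retraction [Nontrivial E] {R : ℝ} (hR : 0 < R) {r : E → E}
    (hr : ContDiff ℝ 1 r) (hn : ∀ x, ‖x‖ ≤ R → ‖r x‖ = R) (hid : ∀ x, ‖x‖ = R → r x = x) :
    False := by
  borelize E
  let μ : Measure E := Measure.addHaar
  let f : E → E := fun x => r x - x
  have hf : ContDiff ℝ 1 f := hr.sub contDiff_id
  have hfd : Differentiable ℝ f := hf.differentiable one_ne_zero
  have hfc : Continuous (fderiv ℝ f) := hf.continuous_fderiv one_ne_zero
  obtain ⟨C, hC0, hC⟩ : ∃ C : ℝ, 0 < C ∧ ∀ x ∈ closedBall (0 : E) R, ‖fderiv ℝ f x‖ ≤ C := by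
    obtain ⟨C, hC⟩ := (isCompact_closedBall (0 : E) R).exists_bound_of_continuousOn
      hfc.continuousOn
    exact ⟨max C 1, by positivity, fun x hx => (hC x hx).trans (le_max_left _ _)⟩
  let F : E → E := fun x => f (ballRetraction R x)
  have hFL : ∀ x y, ‖F x - F y‖ ≤ 2 * C * ‖x - y‖ := by
    intro x y
    have hm : ∀ z : E, ballRetraction R z ∈ closedBall (0 : E) R := fun z => by
      simpa using norm_ballRetraction_le hR z
    have h1 := (convex_closedBall (0 : E) R).norm_image_sub_le_of_norm_fderiv_le
      (fun z _ => hfd z) hC (hm y) (hm x)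
    nlinarith [norm_ballRetraction_sub_le hR x y]
  have hFout : ∀ x, R ≤ ‖x‖ → F x = 0 := by
    intro x hx
    have := hid _ (norm_ballRetraction_of_le hR hx)
    simp [F, f, this]
  have hFin : ∀ x, ‖x‖ ≤ R → F x = f x := fun x hx => by
    simp only [F, ballRetraction_of_mem hR hx]
  -- for small `t`, the map `x ↦ x + t f x` is a bijection of the ball
  have key : ∀ t : ℝ, 0 < t → t * (4 * C) ≤ 1 →
      ∫ x in closedBall (0 : E) R, (1 + t • fderiv ℝ f x).det ∂μ = μ.real (closedBall 0 R) := by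
    intro t ht htC
    have happ : ApproximatesLinearOn (fun x => x + t • F x)
        ((ContinuousLinearEquiv.refl ℝ E : E ≃L[ℝ] E) : E →L[ℝ] E) univ (1 / 2) := by
      intro x _ y _
      have : x + t • F x - (y + t • F y) -
          ((ContinuousLinearEquiv.refl ℝ E : E ≃L[ℝ] E) : E →L[ℝ] E) (x - y) =
          t • (F x - F y) := by
        simp [smul_sub]; abel
      rw [this, norm_smul, Real.norm_of_nonneg ht.le]
      have := hFL x y
      push_cast
      nlinarith [norm_nonneg (x - y)]
    have hcN : Subsingleton E ∨ (1 / 2 : NNReal) <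
        ‖((ContinuousLinearEquiv.refl ℝ E).symm : E →L[ℝ] E)‖₊⁻¹ := by
      right
      have : ‖((ContinuousLinearEquiv.refl ℝ E).symm : E →L[ℝ] E)‖₊ = 1 := by
        ext
        simp
      rw [this]
      norm_num [← NNReal.coe_lt_coe]
    have hinj : Function.Injective (fun x => x + t • F x) := injOn_univ.1 (happ.injOn hcN)
    have hsurj := happ.surjective hcN
    have himg : (fun x => x + t • f x) '' closedBall (0 : E) R = closedBall 0 R := by
      have e : EqOn (fun x => x + t • f x) (fun x => x + t • F x) (closedBall 0 R) := by
        intro x hx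
        simp only [hFin x (by simpa using hx)]
      rw [e.image_eq]
      have h2 : (fun x => x + t • F x) '' (closedBall (0 : E) R)ᶜ = (closedBall 0 R)ᶜ := by
        have : EqOn (fun x => x + t • F x) id (closedBall (0 : E) R)ᶜ := by
          intro x hx
          have : R ≤ ‖x‖ := by
            simp at hx
            exact hx.le
          simp [hFout x this]
        rw [this.image_eq, image_id]
      rw [← compl_inj_iff, ← h2, image_compl_eq ⟨hinj, hsurj⟩]
    have hder : ∀ x ∈ closedBall (0 : E) R, HasFDerivWithinAt (fun x => x + t • f x)
        (1 + t • fderiv ℝ f x) (closedBall 0 R) x := fun x _ =>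
      ((hasFDerivAt_id x).add ((hfd x).hasFDerivAt.const_smul t)).hasFDerivWithinAt
    have hinj' : InjOn (fun x => x + t • f x) (closedBall (0 : E) R) := by
      intro x hx z hz hxz
      apply hinj
      simp only
      rwa [hFin x (by simpa using hx), hFin z (by simpa using hz)]
    have := integral_image_eq_integral_abs_det_fderiv_smul μ measurableSet_closedBall hder hinj'
      (fun _ => (1 : ℝ))
    rw [himg] at this
    simp only [integral_const, smul_eq_mul, mul_one, measureReal_restrict_apply_univ] at this
    rw [this]
    refine setIntegral_congr_fun measurableSet_closedBall fun x hx => ?_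
    refine (abs_of_pos ?_).symm
    apply one_add_det_pos
    rw [norm_smul, Real.norm_of_nonneg ht.le]
    have := hC x hx
    nlinarith
  let v : Fin (Module.finrank ℝ E + 1) → ℝ := fun i => (4 * C)⁻¹ / (i + 1)
  have hv : Function.Injective v := by
    intro i j hij
    have : (0 : ℝ) < 4 * C := by positivity
    simp only [v] at hij
    field_simp at hij
    ext
    exact_mod_cast (add_right_cancel hij).symm
  obtain ⟨w, hw⟩ := exists_weights_det_one_add (E := E) v hv
  have hw1 : ∑ i, w i = 1 := by
    have := hw 0
    simpa [ContinuousLinearMap.det] using this.symm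
  have hzero : ∀ x ∈ ball (0 : E) R, (1 + fderiv ℝ f x).det = 0 := by
    intro x hx
    have hdr : HasFDerivAt r (1 + fderiv ℝ f x) x := by
      have : r = fun x => x + f x := by ext x; simp [f]
      rw [this]
      exact (hasFDerivAt_id x).add (hfd x).hasFDerivAt
    have hrx : r x ≠ 0 := by
      rw [← norm_pos_iff, hn x (mem_ball_zero_iff.1 hx).le]
      exact hR
    have horth : ∀ u, inner ℝ (r x) ((1 + fderiv ℝ f x) u) = 0 := by
      intro u
      have h1 := hdr.norm_sq
      have h2 : HasFDerivAt (fun z => ‖r z‖ ^ 2) (0 : E →L[ℝ] ℝ) x := by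
        refine (hasFDerivAt_const (R ^ 2) x).congr_of_eventuallyEq ?_
        filter_upwards [isOpen_ball.mem_nhds hx] with z hz
        rw [hn z (mem_ball_zero_iff.1 hz).le]
      have h3 := congrArg (fun L : E →L[ℝ] ℝ => L u) (h1.unique h2)
      simp at h3
      simp only [add_apply, one_apply_eq_self, inner_add_right]
      linarith
    by_contra hne
    obtain ⟨u, hu⟩ := (LinearMap.equivOfDetNeZero _ hne).surjective (r x)
    replace hu : (1 + fderiv ℝ f x) u = r x := hu
    have := horth u
    rw [hu, inner_self_eq_zero] at this
    exact hrx this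
  have hpos : 0 < μ.real (closedBall (0 : E) R) := by
    rw [measureReal_def]
    exact ENNReal.toReal_pos (measure_closedBall_pos μ 0 hR).ne' measure_closedBall_lt_top.ne
  have hinter : ∀ t : ℝ, IntegrableOn (fun x => (1 + t • fderiv ℝ f x).det) (closedBall (0 : E) R) μ :=
    fun t => (ContinuousLinearMap.continuous_det.comp (by fun_prop :
      Continuous fun x => 1 + t • fderiv ℝ f x)).continuousOn.integrableOn_compact
        (isCompact_closedBall _ _)
  have htot : ∫ x in closedBall (0 : E) R, (1 + fderiv ℝ f x).det ∂μ = μ.real (closedBall 0 R) := by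
    rw [integral_congr_ae (Eventually.of_forall fun x => hw (fderiv ℝ f x)),
      integral_finsetSum _ fun i _ => (hinter (v i)).const_mul (w i)]
    simp_rw [integral_const_mul]
    calc _ = ∑ i, w i * μ.real (closedBall 0 R) := by
          refine Finset.sum_congr rfl fun i _ => ?_
          rw [key (v i) (by positivity)]
          simp only [v]
          rw [div_mul_eq_mul_div, inv_mul_cancel₀ (by positivity)]
          exact (div_le_one (by positivity)).2 (by linarith [(i : ℕ).cast_nonneg (α := ℝ)])
      _ = _ := by rw [← Finset.sum_mul, hw1, one_mul]
  have hnull : ∫ x in closedBall (0 : E) R, (1 + fderiv ℝ f x).det ∂μ = 0 := by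
    refine setIntegral_eq_zero_of_forall_eq_zero fun x hx => ?_
    rw [← closure_ball (0 : E) hR.ne'] at hx
    exact closure_minimal hzero (isClosed_eq (ContinuousLinearMap.continuous_det.comp (by fun_prop))
      continuous_const) hx
  exact hpos.ne' (htot.symm.trans hnull)


theorem exists_eq_zero_of_near_id [Nontrivial E] {u : E → E}
    (hu : ContinuousOn u (closedBall 0 1)) (hd : ∀ x ∈ closedBall (0 : E) 1, ‖u x - x‖ ≤ 1 / 2) :
    ∃ x ∈ closedBall (0 : E) 1, u x = 0 := by
  by_contra! hne
  have hq : ∀ x : E, ballRetraction 1 x ∈ closedBall (0 : E) 1 := fun x => by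
    simpa using norm_ballRetraction_le one_pos x
  have hqc : Continuous (ballRetraction 1 : E → E) :=
    (LipschitzWith.of_dist_le_mul (K := 2) fun x y => by
      simpa [dist_eq_norm] using norm_ballRetraction_sub_le one_pos x y).continuous
  obtain ⟨δ, hδ, hδu⟩ : ∃ δ : ℝ, 0 < δ ∧ ∀ x ∈ closedBall (0 : E) 1, δ ≤ ‖u x‖ := by
    obtain ⟨x, hx, hmin⟩ := (isCompact_closedBall (0 : E) 1).exists_isMinOn
      ⟨0, by simp⟩ hu.norm
    exact ⟨‖u x‖, norm_pos_iff.2 (hne x hx), hmin⟩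
  obtain ⟨g, hg, hgd, -⟩ := (hu.comp_continuous hqc hq).exists_contDiff_approx 1
    (continuous_const (y := min δ (1 / 4))) (fun _ => by positivity)
  have hg1 : ∀ x, ‖g x - ballRetraction 1 x‖ < 3 / 4 := by
    intro x
    have h1 := (hgd x).trans_le (min_le_right _ _)
    rw [dist_eq_norm] at h1
    have h2 := hd _ (hq x)
    have := norm_sub_le_norm_sub_add_norm_sub (g x) (u (ballRetraction 1 x)) (ballRetraction 1 x)
    simp only [Function.comp_apply] at h1
    linarith
  have hg0 : ∀ x, g x ≠ 0 := by
    intro x h0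
    have h1 := (hgd x).trans_le (min_le_left _ _)
    rw [dist_eq_norm, h0, zero_sub, norm_neg] at h1
    exact absurd h1 (not_lt.2 (hδu _ (hq x)))
  let χ : ContDiffBump (0 : E) := ⟨1, 2, one_pos, one_lt_two⟩
  let G : E → E := fun x => x + χ x • (g x - x)
  have hG : ContDiff ℝ 1 G := contDiff_id.add (χ.contDiff.smul (hg.sub contDiff_id))
  have hG0 : ∀ x, G x ≠ 0 := by
    intro x
    rcases le_total ‖x‖ 1 with hx | hx
    · have : χ x = 1 := χ.one_of_mem_closedBall (by simpa using hx)
      simpa [G, this] using hg0 x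
    · have hx0 : 0 < ‖x‖ := one_pos.trans_le hx
      have h1 : ballRetraction 1 x = ‖x‖⁻¹ • x := by rw [ballRetraction, max_eq_right hx, one_div]
      have h2 : inner ℝ (g x) x = ‖x‖ + inner ℝ (g x - ballRetraction 1 x) x := by
        rw [inner_sub_left, h1, real_inner_smul_left, real_inner_self_eq_norm_sq]
        field_simp
        ring
      have h3 : - (3 / 4 * ‖x‖) ≤ inner ℝ (g x - ballRetraction 1 x) x := by
        have := abs_real_inner_le_norm (g x - ballRetraction 1 x) x
        have := neg_abs_le (inner ℝ (g x - ballRetraction 1 x) x)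
        nlinarith [hg1 x]
      have h4 : inner ℝ (G x) x = (1 - χ x) * ‖x‖ ^ 2 + χ x * inner ℝ (g x) x := by
        simp only [G, inner_add_left, real_inner_smul_left, inner_sub_left,
          real_inner_self_eq_norm_sq]
        ring
      intro h0
      rw [h0, inner_zero_left] at h4
      have h5 := χ.nonneg (x := x)
      have h6 := χ.le_one (x := x)
      have h7 : 0 < inner ℝ (g x) x := by linarith
      rcases h5.eq_or_lt with h | h
      · rw [← h] at h4
        nlinarith
      · have := mul_pos h h7
        nlinarith [mul_nonneg (sub_nonneg.2 h6) (sq_nonneg ‖x‖)]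
  refine not_exists_contDiff_retraction (R := 2) two_pos (r := fun x => (2 / ‖G x‖) • G x)
    ((contDiff_const.div (hG.norm ℝ hG0) fun x => norm_ne_zero_iff.2 (hG0 x)).smul hG)
    (fun x _ => ?_) fun x hx => ?_
  · have := norm_pos_iff.2 (hG0 x)
    rw [norm_smul, Real.norm_of_nonneg (by positivity)]
    field_simp
  · have : χ x = 0 := χ.zero_of_le_dist (by simp [χ, hx])
    simp [G, this, hx]

theorem image_closedBall_mem_nhds [Nontrivial E] {f : E → E}
    (hf : ContinuousOn f (closedBall 0 1)) (hfi : InjOn f (closedBall 0 1)) :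
    f '' closedBall 0 1 ∈ 𝓝 (f 0) := by
  borelize E
  let μ : Measure E := Measure.addHaar
  have h0B : (0 : E) ∈ closedBall (0 : E) 1 := by simp
  have hB := isCompact_closedBall (0 : E) 1
  set K := f '' closedBall 0 1 with hKdef
  have hK : IsCompact K := hB.image_of_continuousOn hf
  obtain ⟨G, hG⟩ : ∃ G : C(E, E), ∀ x ∈ closedBall (0 : E) 1, G (f x) = x := by
    have : CompactSpace (closedBall (0 : E) 1) := isCompact_iff_compactSpace.1 hB
    have he : IsClosedEmbedding ((closedBall (0 : E) 1).domRestrict f) :=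
      hf.domRestrict.isClosedEmbedding hfi.injective
    have := TietzeExtension.of_tvs ℝ (E := E)
    obtain ⟨G, hG⟩ := ContinuousMap.exists_extension he ⟨Subtype.val, continuous_subtype_val⟩
    exact ⟨G, fun x hx => DFunLike.congr_fun hG ⟨x, hx⟩⟩
  by_contra hcon
  have hf0 : G (f 0) = 0 := hG 0 h0B
  obtain ⟨ε, hε, hGε⟩ : ∃ ε > 0, ∀ y, dist y (f 0) < 2 * ε → ‖G y‖ < 1 / 10 := by
    obtain ⟨η, hη, h⟩ := Metric.continuous_iff.1 G.continuous (f 0) (1 / 10) (by norm_num)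
    refine ⟨η / 2, half_pos hη, fun y hy => ?_⟩
    have := h y (by linarith)
    rwa [hf0, dist_zero_right] at this
  obtain ⟨c, hcd, hcK⟩ : ∃ c, dist c (f 0) < ε ∧ c ∉ K := by
    by_contra! h
    exact hcon (mem_of_superset (ball_mem_nhds _ hε) fun c hc => h c hc)
  obtain ⟨δ, hδ, hδG⟩ : ∃ δ : ℝ, 0 < δ ∧ ∀ y ∈ K, ε ≤ dist y c → δ ≤ ‖G y‖ := by
    have hS : IsCompact (K ∩ {y | ε ≤ dist y c}) :=
      hK.inter_right (isClosed_le continuous_const (continuous_id.dist continuous_const))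
    rcases (K ∩ {y | ε ≤ dist y c}).eq_empty_or_nonempty with he | hne
    · exact ⟨1, one_pos, fun y hy hyc => absurd (he ▸ ⟨hy, hyc⟩ : y ∈ (∅ : Set E)) id⟩
    obtain ⟨y, ⟨⟨x, hx, rfl⟩, hyc⟩, hmin⟩ := hS.exists_isMinOn hne G.continuous.norm.continuousOn
    refine ⟨‖G (f x)‖, norm_pos_iff.2 fun h => ?_, fun z hz hzc => hmin ⟨hz, hzc⟩⟩
    rw [hG x hx] at h
    rw [h, mem_ofPred_eq, dist_comm] at hyc
    linarith
  set η := min (δ / 2) (1 / 20) with hη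
  have hη0 : 0 < η := by positivity
  obtain ⟨P, hP, hPd, -⟩ := G.continuous.exists_contDiff_approx 1
    (continuous_const (y := η)) (fun _ => hη0)
  obtain ⟨a, ha, haP⟩ : ∃ a ∈ ball (0 : E) η, a ∉ P '' sphere c ε := by
    by_contra! h
    have h1 : μ (P '' sphere c ε) = 0 :=
      addHaar_image_eq_zero_of_differentiableOn_of_addHaar_eq_zero μ
        (hP.differentiable one_ne_zero).differentiableOn (Measure.addHaar_sphere μ c ε)
    exact (measure_ball_pos μ (0 : E) hη0).ne' (measure_mono_null h h1)
  have hPa : ∀ y, ‖P y - a - G y‖ < 2 * η := by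
    intro y
    have h1 := hPd y
    rw [dist_eq_norm] at h1
    rw [sub_right_comm]
    have := norm_sub_le (P y - G y) a
    have := mem_ball_zero_iff.1 ha
    linarith
  let Φ : E → E := fun y => c + (max (ε / ‖y - c‖) 1) • (y - c)
  have hyc : ∀ y ∈ K, 0 < ‖y - c‖ := fun y hy =>
    norm_pos_iff.2 (sub_ne_zero.2 fun h => hcK (h ▸ hy))
  have hΦ : ContinuousOn Φ K := by
    refine continuousOn_const.add (ContinuousOn.smul (ContinuousOn.sup ?_ continuousOn_const)
      (by fun_prop))
    exact continuousOn_const.div (by fun_prop) fun y hy => (hyc y hy).ne'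
  have hΦ1 : ∀ y ∈ K, ε ≤ ‖y - c‖ → Φ y = y := by
    intro y hy h
    have : ε / ‖y - c‖ ≤ 1 := (div_le_one (hyc y hy)).2 h
    simp [Φ, max_eq_right this]
  have hΦ2 : ∀ y ∈ K, ‖y - c‖ ≤ ε → Φ y ∈ sphere c ε := by
    intro y hy h
    have h1 : 1 ≤ ε / ‖y - c‖ := (one_le_div (hyc y hy)).2 h
    have := hyc y hy
    simp only [Φ, max_eq_left h1, mem_sphere, dist_self_add_left, norm_smul, norm_div, norm_norm,
      Real.norm_of_nonneg hε.le]
    field_simp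
  have hη1 : η ≤ δ / 2 := min_le_left _ _
  have hη2 : η ≤ 1 / 20 := min_le_right _ _
  obtain ⟨x, hx, hx0⟩ := exists_eq_zero_of_near_id (u := fun x => P (Φ (f x)) - a)
    (((hP.continuous.comp_continuousOn hΦ).comp hf (mapsTo_image _ _)).sub continuousOn_const)
    (by
      intro x hx
      have hfx : f x ∈ K := mem_image_of_mem f hx
      have h1 := hPa (Φ (f x))
      rcases le_total ε ‖f x - c‖ with h | h
      · rw [hΦ1 _ hfx h, hG x hx] at h1
        rw [hΦ1 _ hfx h]
        linarith
      · have h2 := hΦ2 _ hfx h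
        have h3 : ‖G (Φ (f x))‖ < 1 / 10 := hGε _ (by
          have := dist_triangle (Φ (f x)) c (f 0)
          rw [mem_sphere.1 h2] at this
          linarith)
        have h4 : ‖G (f x)‖ < 1 / 10 := hGε _ (by
          have := dist_triangle (f x) c (f 0)
          rw [dist_eq_norm (f x) c] at this
          linarith)
        rw [hG x hx] at h4
        have e : P (Φ (f x)) - a - x = (P (Φ (f x)) - a - G (Φ (f x))) + (G (Φ (f x)) - x) := by
          abel
        rw [e]
        have := norm_add_le (P (Φ (f x)) - a - G (Φ (f x))) (G (Φ (f x)) - x)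
        have := norm_sub_le (G (Φ (f x))) x
        linarith)
  have hfx : f x ∈ K := mem_image_of_mem f hx
  rcases le_total ‖f x - c‖ ε with h | h
  · exact haP ⟨_, hΦ2 _ hfx h, sub_eq_zero.1 hx0⟩
  · have h1 := hPa (Φ (f x))
    rw [hx0, hΦ1 _ hfx h, zero_sub, norm_neg] at h1
    have := hδG _ hfx (by rwa [dist_eq_norm])
    linarith

/-- Invariance of domain. -/
theorem isOpen_image_of_injOn {f : E → E} {U : Set E} (hU : IsOpen U)
    (hf : ContinuousOn f U) (hfi : InjOn f U) : IsOpen (f '' U) := by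
  rcases subsingleton_or_nontrivial E with _ | _
  · exact isOpen_discrete _
  rw [isOpen_iff_mem_nhds]
  rintro _ ⟨x, hx, rfl⟩
  obtain ⟨r, hr, hrU⟩ := nhds_basis_closedBall.mem_iff.1 (hU.mem_nhds hx)
  have hmaps : MapsTo (fun z : E => x + r • z) (closedBall 0 1) U := by
    intro z hz
    apply hrU
    rw [mem_closedBall_zero_iff] at hz
    simp only [mem_closedBall, dist_self_add_left, norm_smul, Real.norm_of_nonneg hr.le]
    nlinarith
  have := image_closedBall_mem_nhds (f := fun z => f (x + r • z))
    (hf.comp (by fun_prop) hmaps) (hfi.comp (fun z _ w _ h => by simpa [hr.ne'] using h) hmaps)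
  simp only [smul_zero, add_zero] at this
  refine mem_of_superset this ?_
  rintro _ ⟨z, hz, rfl⟩
  exact mem_image_of_mem f (hmaps hz)

end InvarianceOfDomain

section Schoenflies
variable {E : Type*} [NormedAddCommGroup E] [InnerProductSpace ℝ E]

/-- The map preserving rays from `q` and acting on distances to `q` by `ψ`. -/
noncomputable def radialMap (q : E) (ψ : ℝ → ℝ) (y : E) : E := q + (ψ ‖y - q‖ / ‖y - q‖) • (y - q)

theorem norm_radialMap_sub {q y : E} {ψ : ℝ → ℝ} (hy : y ≠ q) (hψ : 0 ≤ ψ ‖y - q‖) :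
    ‖radialMap q ψ y - q‖ = ψ ‖y - q‖ := by
  have : 0 < ‖y - q‖ := norm_pos_iff.2 (sub_ne_zero.2 hy)
  rw [radialMap, add_sub_cancel_left, norm_smul, Real.norm_of_nonneg (by positivity)]
  field_simp

theorem radialMap_of_eq {q y : E} {ψ : ℝ → ℝ} (h : ψ ‖y - q‖ = ‖y - q‖) :
    radialMap q ψ y = y := by
  rcases eq_or_ne y q with rfl | hy
  · simp [radialMap]
  · rw [radialMap, h, div_self (norm_ne_zero_iff.2 (sub_ne_zero.2 hy)), one_smul, add_sub_cancel]

theorem radialMap_self (q : E) (ψ : ℝ → ℝ) : radialMap q ψ q = q := by simp [radialMap]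

theorem continuousOn_radialMap (q : E) {ψ : ℝ → ℝ} (hψ : Continuous ψ) :
    ContinuousOn (radialMap q ψ) {q}ᶜ := by
  refine continuousOn_const.add (ContinuousOn.smul (ContinuousOn.div (by fun_prop) (by fun_prop)
    fun y hy => ?_) (by fun_prop))
  exact norm_ne_zero_iff.2 (sub_ne_zero.2 hy)

theorem continuous_radialMap (q : E) {ψ : ℝ → ℝ} (hψ : Continuous ψ)
    (h0 : ∀ s, 0 ≤ s → 0 ≤ ψ s) (hle : ∀ s, 0 ≤ s → ψ s ≤ s) : Continuous (radialMap q ψ) := by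
  rw [continuous_iff_continuousAt]
  intro y
  rcases eq_or_ne y q with rfl | hy
  · rw [ContinuousAt, radialMap_self, tendsto_iff_norm_sub_tendsto_zero]
    refine squeeze_zero (fun _ => norm_nonneg _) (g := fun z => ‖z - y‖) (fun z => ?_) ?_
    · rcases eq_or_ne z y with rfl | hz
      · simp [radialMap]
      · rw [norm_radialMap_sub hz (h0 _ (norm_nonneg _))]
        exact hle _ (norm_nonneg _)
    · exact (continuous_id.sub continuous_const).norm.tendsto' _ _ (by simp)
  · exact (continuousOn_radialMap q hψ).continuousAt (isOpen_compl_singleton.mem_nhds hy)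

theorem injOn_radialMap (q : E) {ψ : ℝ → ℝ} (hψ : StrictMono ψ)
    (h0 : ∀ s, 0 < s → 0 < ψ s) : InjOn (radialMap q ψ) {q}ᶜ := by
  intro y hy z hz h
  have hy' : 0 < ‖y - q‖ := norm_pos_iff.2 (sub_ne_zero.2 hy)
  have hz' : 0 < ‖z - q‖ := norm_pos_iff.2 (sub_ne_zero.2 hz)
  have h1 : ‖y - q‖ = ‖z - q‖ := by
    apply hψ.injective
    rw [← norm_radialMap_sub hy (h0 _ hy').le, ← norm_radialMap_sub hz (h0 _ hz').le, h]
  rw [radialMap, radialMap, h1, add_right_inj] at h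
  have h2 : ψ ‖z - q‖ / ‖z - q‖ ≠ 0 := (div_pos (h0 _ hz') hz').ne'
  exact sub_left_injective (smul_right_injective E h2 h)

theorem injective_radialMap (q : E) {ψ : ℝ → ℝ} (hψ : StrictMono ψ)
    (h0 : ∀ s, 0 < s → 0 < ψ s) : Function.Injective (radialMap q ψ) := by
  have hne : ∀ y, y ≠ q → radialMap q ψ y ≠ q := by
    intro y hy h
    have hy' : 0 < ‖y - q‖ := norm_pos_iff.2 (sub_ne_zero.2 hy)
    have := norm_radialMap_sub hy (h0 _ hy').le
    rw [h, sub_self, norm_zero] at this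
    exact (h0 _ hy').ne this
  intro y z h
  rcases eq_or_ne y q with rfl | hy <;> rcases eq_or_ne z y with rfl | hzy
  · rfl
  · rw [radialMap_self] at h
    exact absurd h.symm (hne z hzy)
  · rfl
  · rcases eq_or_ne z q with rfl | hz
    · rw [radialMap_self] at h
      exact absurd h (hne y hy)
    · exact injOn_radialMap q hψ h0 hy hz h

variable [FiniteDimensional ℝ E]

theorem exists_openPartialHomeomorph {f : E → E} {U : Set E} (hU : IsOpen U)
    (hf : ContinuousOn f U) (hfi : InjOn f U) :
    ∃ e : OpenPartialHomeomorph E E, e.source = U ∧ e.target = f '' U ∧ ∀ x, e x = f x := by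
  rcases isEmpty_or_nonempty E with h | h
  · exact isEmptyElim (0 : E)
  refine ⟨OpenPartialHomeomorph.ofContinuousOpenRestrict (hfi.toPartialEquiv f U) hf ?_ hU, rfl, rfl,
    fun _ => rfl⟩
  rw [IsOpenMap]
  intro s hs
  obtain ⟨t, ht, rfl⟩ := isOpen_induced_iff.1 hs
  have : (U.domRestrict f) '' (Subtype.val ⁻¹' t) = f '' (U ∩ t) := by
    ext y; simp only [mem_image, mem_inter_iff, mem_preimage, Subtype.exists, domRestrict_apply]; grind
  erw [this]
  exact isOpen_image_of_injOn (hU.inter ht) (hf.mono inter_subset_left) (hfi.mono inter_subset_left)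

/-- `c` is an embedding of the punctured space whose image is the region `0 < τ < 1`, where `τ`
is a continuous height function with `τ (c z) = ‖z‖ / (1 + ‖z‖)` and compact sublevel sets. -/
structure IsCollar (c : OpenPartialHomeomorph E E) (τ : E → ℝ) : Prop where
  source : c.source = {0}ᶜ
  target : c.target = {x | 0 < τ x ∧ τ x < 1}
  height : ∀ z ≠ 0, τ (c z) = ‖z‖ / (1 + ‖z‖)
  continuous : Continuous τ
  isCompact : ∀ b < 1, IsCompact {x | τ x ≤ b}

namespace IsCollar
variable {c : OpenPartialHomeomorph E E} {τ : E → ℝ} (h : IsCollar c τ)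
include h

theorem apply_mem {z : E} (hz : z ≠ 0) : 0 < τ (c z) ∧ τ (c z) < 1 := by
  have := c.map_source (x := z) (by rw [h.source]; exact hz)
  rwa [h.target] at this

theorem symm_ne {x : E} (h0 : 0 < τ x) (h1 : τ x < 1) : c.symm x ≠ 0 := by
  have := c.map_target (x := x) (by rw [h.target]; exact ⟨h0, h1⟩)
  rwa [h.source] at this

theorem apply_symm {x : E} (h0 : 0 < τ x) (h1 : τ x < 1) : c (c.symm x) = x :=
  c.right_inv (by rw [h.target]; exact ⟨h0, h1⟩)

theorem symm_apply {z : E} (hz : z ≠ 0) : c.symm (c z) = z :=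
  c.left_inv (by rw [h.source]; exact hz)

theorem injOn : InjOn c {0}ᶜ := h.source ▸ c.injOn

theorem continuousOn : ContinuousOn c {0}ᶜ := h.source ▸ c.continuousOn

/-- Sublevel sets of the height function form a neighbourhood basis of the core. -/
theorem exists_sublevel_subset {U : Set E} (hU : IsOpen U) (hX : ∀ x, τ x ≤ 0 → x ∈ U) {b : ℝ}
    (hb : 0 < b) (hb1 : b < 1) : ∃ b' > 0, b' < b ∧ ∀ x, τ x ≤ b' → x ∈ U := by
  have hK : IsCompact ({x | τ x ≤ b} \ U) := (h.isCompact b hb1).diff hU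
  rcases ({x | τ x ≤ b} \ U).eq_empty_or_nonempty with he | hne
  · refine ⟨b / 2, by positivity, by linarith, fun x hx => ?_⟩
    by_contra hxU
    exact (he ▸ ⟨show τ x ≤ b by linarith, hxU⟩ : x ∈ (∅ : Set E))
  · obtain ⟨y, ⟨hyb, hyU⟩, hmin⟩ := hK.exists_isMinOn hne h.continuous.continuousOn
    have hy : 0 < τ y := by
      by_contra hy
      exact hyU (hX y (not_lt.1 hy))
    refine ⟨τ y / 2, by positivity, ?_, fun x hx => ?_⟩
    · have : τ y ≤ b := hyb
      linarith
    · by_contra hxU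
      have h1 : τ y ≤ b := hyb
      have : τ y ≤ τ x := hmin (a := x) ⟨show τ x ≤ b by linarith, hxU⟩
      linarith

/-- Some round ball contains the core but misses a point of the collar. -/
theorem exists_ball [Nontrivial E] : ∃ P ≠ (0 : E), ∃ R > 0, R < ‖c P‖ ∧ ∀ x, τ x ≤ 0 → ‖x‖ < R := by
  obtain ⟨e, he⟩ := exists_ne (0 : E)
  have hK := h.isCompact (1 / 2) (by norm_num)
  obtain ⟨u, hu⟩ := exists_norm_eq E (zero_le_one (α := ℝ))
  have hu0 : u ≠ 0 := norm_pos_iff.1 (by rw [hu]; exact one_pos)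
  have huK : c u ∈ {x | τ x ≤ 1 / 2} := by
    show τ (c u) ≤ 1 / 2
    rw [h.height u hu0, hu]; norm_num
  have hmax : ∀ p, τ p ≤ 1 / 2 → (∀ x, τ x ≤ 1 / 2 → ‖x‖ ≤ ‖p‖) → τ p = 1 / 2 := by
    intro p hp hpm
    by_contra hne
    have hlt : τ p < 1 / 2 := lt_of_le_of_ne hp hne
    obtain ⟨v, hv, hpv⟩ : ∃ v : E, v ≠ 0 ∧ 0 ≤ inner ℝ p v := by
      rcases eq_or_ne p 0 with rfl | hp0
      · exact ⟨e, he, by simp⟩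
      · exact ⟨p, hp0, real_inner_self_nonneg⟩
    have hc : Tendsto (fun t : ℝ => τ (p + t • v)) (𝓝[>] 0) (𝓝 (τ p)) :=
      ((h.continuous.comp (by fun_prop : Continuous fun t : ℝ => p + t • v)).tendsto' 0 _
        (by simp)).mono_left nhdsWithin_le_nhds
    obtain ⟨t, ht, ht0⟩ := ((hc.eventually (gt_mem_nhds hlt)).and self_mem_nhdsWithin).exists
    have h1 := hpm _ ht.le
    have h2 := norm_add_sq_real p (t • v)
    rw [real_inner_smul_right, norm_smul, Real.norm_of_nonneg (le_of_lt ht0)] at h2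
    have h3 : 0 < (t * ‖v‖) ^ 2 := by
      have := norm_pos_iff.2 hv
      have : 0 < t := ht0
      positivity
    have h4 : 0 ≤ t * inner ℝ p v := mul_nonneg (le_of_lt ht0) hpv
    nlinarith [norm_nonneg (p + t • v), norm_nonneg p]
  obtain ⟨p, hpK, hp⟩ := hK.exists_isMaxOn ⟨_, huK⟩ continuous_norm.continuousOn
  replace hp : ∀ x, τ x ≤ 1 / 2 → ‖x‖ ≤ ‖p‖ := fun x hx => hp hx
  have hpτ := hmax p hpK hp
  have hp0 : 0 < ‖p‖ := by
    by_contra hcon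
    have hz : ∀ z : E, ‖z‖ = 1 → c z = 0 := by
      intro z hz
      have hz0 : z ≠ 0 := norm_pos_iff.1 (by rw [hz]; exact one_pos)
      have := hp (c z) (by rw [h.height z hz0, hz]; norm_num)
      exact norm_le_zero_iff.1 (this.trans (not_lt.1 hcon))
    have := h.injOn hu0 (neg_ne_zero.2 hu0) ((hz u hu).trans (hz (-u) (by rwa [norm_neg])).symm)
    have h2 : (2 : ℝ) • u = 0 := by
      rw [two_smul]
      exact eq_neg_iff_add_eq_zero.1 this
    exact hu0 ((smul_eq_zero.1 h2).resolve_left two_ne_zero)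
  have hX : ∀ x, τ x ≤ 0 → ‖x‖ < ‖p‖ := by
    intro x hx
    refine lt_of_le_of_ne (hp x (by linarith)) fun heq => ?_
    have := hmax x (by linarith) (heq ▸ hp)
    linarith
  obtain ⟨q, hq, hqm⟩ := ((h.isCompact 0 one_pos).insert 0).exists_isMaxOn
    (insert_nonempty _ _) continuous_norm.continuousOn
  have hqp : ‖q‖ < ‖p‖ := by
    rcases hq with rfl | hq
    · simpa using hp0
    · exact hX q hq
  refine ⟨c.symm p, h.symm_ne (by linarith) (by linarith), (‖q‖ + ‖p‖) / 2, by positivity, ?_,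
    fun x hx => ?_⟩
  · rw [h.apply_symm (by linarith) (by linarith)]
    linarith
  · have : ‖x‖ ≤ ‖q‖ := hqm (mem_insert_of_mem 0 hx)
    linarith

theorem norm_symm {x : E} (h0 : 0 < τ x) (h1 : τ x < 1) : ‖c.symm x‖ = τ x / (1 - τ x) := by
  have h2 := h.height _ (h.symm_ne h0 h1)
  rw [h.apply_symm h0 h1] at h2
  have h3 := norm_nonneg (c.symm x)
  have h4 : 0 < 1 - τ x := by linarith
  rw [h2]
  field_simp
  ring

open Classical in
theorem continuousOn_ite_symm :
    ContinuousOn (fun x => if 0 < τ x then c.symm x else 0) {x | τ x < 1} := by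
  have ho : IsOpen {x | τ x < 1} := isOpen_lt h.continuous continuous_const
  intro x hx
  refine ContinuousAt.continuousWithinAt ?_
  by_cases h0 : 0 < τ x
  · have h1 : ContinuousAt c.symm x :=
      c.symm.continuousAt (by rw [c.symm_source, h.target]; exact ⟨h0, hx⟩)
    refine h1.congr ?_
    filter_upwards [(isOpen_lt continuous_const h.continuous).mem_nhds h0] with z hz
    exact (if_pos hz).symm
  · rw [ContinuousAt, if_neg h0, tendsto_zero_iff_norm_tendsto_zero]
    have h1 : Tendsto (fun z => max (τ z) 0 / (1 - τ z)) (𝓝 x) (𝓝 0) := by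
      have : ContinuousAt (fun z => max (τ z) 0 / (1 - τ z)) x := by
        have hc := h.continuous
        refine ContinuousAt.div (by fun_prop) (by fun_prop) ?_
        have : τ x < 1 := hx
        linarith
      rw [ContinuousAt, max_eq_right (not_lt.1 h0), zero_div] at this
      exact this
    refine squeeze_zero' (Eventually.of_forall fun _ => norm_nonneg _) ?_ h1
    filter_upwards [ho.mem_nhds hx] with z hz
    have hz1 : τ z < 1 := hz
    by_cases hz0 : 0 < τ z
    · rw [if_pos hz0, h.norm_symm hz0 hz1, max_eq_left hz0.le]
    · rw [if_neg hz0, norm_zero]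
      exact div_nonneg (le_max_right _ _) (by linarith)

/-- A map collapsing the core `τ ≤ 0` to a point, at the price of a puncture at `c P`. -/
theorem exists_collapse {P : E} (hP : P ≠ 0) : ∃ (g : E → E) (q : E),
    ContinuousOn g {c P}ᶜ ∧ (∀ x ≠ c P, g x = q ↔ τ x ≤ 0) ∧
    (∀ x ≠ c P, ∀ x' ≠ c P, g x = g x' → x = x' ∨ (τ x ≤ 0 ∧ τ x' ≤ 0)) ∧
    ∀ b > 0, ∃ ε > 0, ∀ y ∈ ball q ε, y ≠ q → ∃ x, 0 < τ x ∧ τ x < b ∧ x ≠ c P ∧ g x = y := by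
  classical
  have hP0 : 0 < ‖P‖ := norm_pos_iff.2 hP
  set Q : E → E := fun x => if 0 < τ x then c.symm x else 0 with hQ
  have hQc : ContinuousOn Q {x | τ x < 1} := h.continuousOn_ite_symm
  set ψ : ℝ → ℝ := fun s => max s (2 * ‖P‖ + s / 2) with hψ
  have hψc : Continuous ψ := by fun_prop
  have hψm : StrictMono ψ := fun s t hst => max_lt_max hst (by linarith)
  have hψ0 : ∀ s, 0 < s → 0 < ψ s := fun s hs => lt_max_of_lt_left hs
  set H := radialMap P ψ with hH
  have hHc : ContinuousOn H {P}ᶜ := continuousOn_radialMap P hψc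
  have hHi : InjOn H {P}ᶜ := injOn_radialMap P hψm hψ0
  have hH0 : ∀ z, z ≠ P → H z ≠ 0 := by
    intro z hz h0
    have hz' : 0 < ‖z - P‖ := norm_pos_iff.2 (sub_ne_zero.2 hz)
    have h1 : ‖H z - P‖ = ψ ‖z - P‖ := norm_radialMap_sub hz (hψ0 _ hz').le
    rw [h0, zero_sub, norm_neg] at h1
    have h2 : 2 * ‖P‖ + ‖z - P‖ / 2 ≤ ψ ‖z - P‖ := le_max_right _ _
    linarith
  have hHid : ∀ z, 5 * ‖P‖ ≤ ‖z‖ → H z = z := by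
    intro z hz
    refine radialMap_of_eq (max_eq_left ?_)
    have := norm_sub_norm_le z P
    linarith
  have hQP : ∀ x, τ x < 1 → x ≠ c P → Q x ≠ P := by
    intro x hx hxP hQx
    by_cases h0 : 0 < τ x
    · simp only [hQ, if_pos h0] at hQx
      exact hxP (by rw [← hQx, h.apply_symm h0 hx])
    · simp only [hQ, if_neg h0] at hQx
      exact hP hQx.symm
  set g : E → E := fun x => if τ x < 1 then c (H (Q x)) else x with hg
  have hg1 : ∀ x, τ x < 1 → g x = c (H (Q x)) := fun x hx => if_pos hx
  have hg2 : ∀ x, ¬ τ x < 1 → g x = x := fun x hx => if_neg hx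
  have hgz : ∀ z, z ≠ 0 → g (c z) = c (H z) := by
    intro z hz
    obtain ⟨h0, h1⟩ := h.apply_mem hz
    rw [hg1 _ h1]
    simp only [hQ, if_pos h0, h.symm_apply hz]
  have hgid : ∀ x, 5 * ‖P‖ / (1 + 5 * ‖P‖) < τ x → g x = x := by
    intro x hx
    by_cases h1 : τ x < 1
    · have h0 : 0 < τ x := lt_of_le_of_lt (by positivity) hx
      have h2 := h.norm_symm h0 h1
      rw [← h.apply_symm h0 h1, hgz _ (h.symm_ne h0 h1), hHid]
      rw [h2, le_div_iff₀ (by linarith)]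
      rw [div_lt_iff₀ (by positivity)] at hx
      linarith
    · exact hg2 x h1
  refine ⟨g, c (H 0), ?_, ?_, ?_, ?_⟩
  · intro x hx
    refine ContinuousAt.continuousWithinAt ?_
    by_cases h1 : τ x < 1
    · have hO : IsOpen ({x | τ x < 1} ∩ {c P}ᶜ) :=
        (isOpen_lt h.continuous continuous_const).inter isOpen_compl_singleton
      have hcc : ContinuousOn (fun x => c (H (Q x))) ({x | τ x < 1} ∩ {c P}ᶜ) := by
        refine h.continuousOn.comp (t := {0}ᶜ)
          (ContinuousOn.comp (g := H) (f := Q) (t := {P}ᶜ) hHc (hQc.mono inter_subset_left) ?_) ?_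
        · exact fun y hy => hQP y hy.1 hy.2
        · exact fun y hy => hH0 _ (hQP y hy.1 hy.2)
      refine (hcc.continuousAt (hO.mem_nhds ⟨h1, hx⟩)).congr ?_
      filter_upwards [hO.mem_nhds ⟨h1, hx⟩] with z hz
      exact (hg1 z hz.1).symm
    · refine continuousAt_id.congr ?_
      have h2 : 5 * ‖P‖ / (1 + 5 * ‖P‖) < τ x := by
        refine lt_of_lt_of_le ?_ (not_lt.1 h1)
        rw [div_lt_one (by positivity)]
        linarith
      filter_upwards [(isOpen_lt continuous_const h.continuous).mem_nhds h2] with z hz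
      exact (hgid z hz).symm
  · intro x hxP
    constructor
    · intro hgx
      by_cases h1 : τ x < 1
      · rw [hg1 x h1] at hgx
        have h3 := hHi (hQP x h1 hxP) hP.symm (h.injOn (hH0 _ (hQP x h1 hxP)) (hH0 _ hP.symm) hgx)
        by_contra h4
        simp only [hQ, if_pos (not_le.1 h4)] at h3
        exact h.symm_ne (not_le.1 h4) h1 h3
      · rw [hg2 x h1] at hgx
        exact absurd (hgx ▸ (h.apply_mem (hH0 _ hP.symm)).2) h1
    · intro hx
      rw [hg1 x (by linarith)]
      simp only [hQ, if_neg (not_lt.2 hx)]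
  · have hmem : ∀ x, x ≠ c P → τ x < 1 → τ (g x) < 1 := fun x hxP hx => by
      rw [hg1 x hx]
      exact (h.apply_mem (hH0 _ (hQP x hx hxP))).2
    intro x hx x' hx' he
    by_cases h1 : τ x < 1 <;> by_cases h2 : τ x' < 1
    · rw [hg1 x h1, hg1 x' h2] at he
      have h3 := hHi (hQP x h1 hx) (hQP x' h2 hx') (h.injOn (hH0 _ (hQP x h1 hx))
        (hH0 _ (hQP x' h2 hx')) he)
      by_cases h4 : 0 < τ x <;> by_cases h5 : 0 < τ x'
      · left
        simp only [hQ, if_pos h4, if_pos h5] at h3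
        rw [← h.apply_symm h4 h1, h3, h.apply_symm h5 h2]
      · simp only [hQ, if_pos h4, if_neg h5] at h3
        exact absurd h3 (h.symm_ne h4 h1)
      · simp only [hQ, if_neg h4, if_pos h5] at h3
        exact absurd h3.symm (h.symm_ne h5 h2)
      · exact Or.inr ⟨not_lt.1 h4, not_lt.1 h5⟩
    · have := hmem x hx h1
      rw [he, hg2 x' h2] at this
      exact absurd this h2
    · have := hmem x' hx' h2
      rw [← he, hg2 x h1] at this
      exact absurd this h1
    · rw [hg2 x h1, hg2 x' h2] at he
      exact Or.inl he
  · intro b hb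
    set ρ := min ‖P‖ b with hρ
    have hρ0 : 0 < ρ := lt_min hP0 hb
    have hUP : ball (0 : E) ρ ⊆ {P}ᶜ := by
      intro z hz hzP
      rw [mem_singleton_iff] at hzP
      rw [hzP, mem_ball_zero_iff] at hz
      exact absurd hz (not_lt.2 (min_le_left _ _))
    have hmaps : MapsTo H (ball (0 : E) ρ) {0}ᶜ := fun z hz => hH0 z (hUP hz)
    have himg : IsOpen ((c ∘ H) '' ball (0 : E) ρ) := isOpen_image_of_injOn isOpen_ball
      (h.continuousOn.comp (hHc.mono hUP) hmaps) (h.injOn.comp (hHi.mono hUP) hmaps)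
    obtain ⟨ε, hε, hsub⟩ := Metric.isOpen_iff.1 himg (c (H 0)) ⟨0, mem_ball_self hρ0, rfl⟩
    refine ⟨ε, hε, fun y hy hyq => ?_⟩
    obtain ⟨z, hz, rfl⟩ := hsub hy
    have hz0 : z ≠ 0 := by
      rintro rfl
      exact hyq rfl
    have hzp := norm_pos_iff.2 hz0
    refine ⟨c z, (h.apply_mem hz0).1, ?_, fun he => hUP hz (h.injOn hz0 hP he), hgz z hz0⟩
    rw [h.height z hz0, div_lt_iff₀ (by positivity)]
    have : ‖z‖ < b := (mem_ball_zero_iff.1 hz).trans_le (min_le_right _ _)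
    nlinarith

/-- A ball containing the core embeds into any given sublevel set, relative to the core. -/
theorem exists_ball_embedding {P : E} (hP : P ≠ 0) {R : ℝ} (hRP : R < ‖c P‖)
    (hX : ∀ x, τ x ≤ 0 → ‖x‖ < R) {b : ℝ} (hb : 0 < b) (hb1 : b < 1) :
    ∃ G : E → E, ContinuousOn G (closedBall 0 R) ∧ InjOn G (closedBall 0 R) ∧
      (∀ x ∈ closedBall (0 : E) R, τ (G x) < b) ∧ ∃ b' > 0, b' < b ∧ ∀ x, τ x ≤ b' → G x = x := by
  classical
  obtain ⟨g, q, hgc, hgq, hgi, hgs⟩ := h.exists_collapse hP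
  obtain ⟨b0, hb0, hb0b, hb0R⟩ := h.exists_sublevel_subset isOpen_ball (U := ball 0 R)
    (fun x hx => mem_ball_zero_iff.2 (hX x hx)) hb hb1
  have hDP : ∀ x ∈ closedBall (0 : E) R, x ≠ c P := by
    rintro x hx rfl
    exact absurd (mem_closedBall_zero_iff.1 hx) (not_le.2 hRP)
  have hτP : ∀ x, τ x ≤ b0 → x ≠ c P := fun x hx => hDP x (ball_subset_closedBall (hb0R x hx))
  have hO : IsOpen {x | 0 < τ x ∧ τ x < b0} := (isOpen_lt continuous_const h.continuous).inter
    (isOpen_lt h.continuous continuous_const)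
  obtain ⟨e, hes, het, he⟩ := exists_openPartialHomeomorph hO
    (hgc.mono fun x hx => hτP x hx.2.le) (fun x hx x' hx' hxx' =>
      (hgi x (hτP x hx.2.le) x' (hτP x' hx'.2.le) hxx').resolve_right
        fun hn => absurd hx.1 (not_lt.2 hn.1))
  obtain ⟨ε, hε, hball⟩ := hgs b0 hb0
  have htarget : ∀ y ∈ ball q ε, y ≠ q → y ∈ e.target := by
    intro y hy hyq
    obtain ⟨x, hx0, hxb, -, rfl⟩ := hball y hy hyq
    rw [het]
    exact ⟨x, ⟨hx0, hxb⟩, rfl⟩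
  obtain ⟨M, hM⟩ : ∃ M, ∀ x ∈ closedBall (0 : E) R, ‖g x - q‖ ≤ M :=
    (isCompact_closedBall 0 R).exists_bound_of_continuousOn
      (f := fun x => g x - q) ((hgc.mono hDP).sub continuousOn_const)
  set a := ε / (2 * (|M| + 1)) with ha
  have ha0 : 0 < a := by positivity
  have haM : a * (|M| + 1) = ε / 2 := by rw [ha]; field_simp
  set ψ : ℝ → ℝ := fun s => min s (ε / 2 + s * a) with hψ
  have hψc : Continuous ψ := by fun_prop
  have hψm : StrictMono ψ := fun s t hst => min_lt_min hst (by nlinarith)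
  have hψ0 : ∀ s, 0 < s → 0 < ψ s := fun s hs => lt_min hs (by positivity)
  set σ := radialMap q ψ with hσ
  have hσc : Continuous σ := continuous_radialMap q hψc (fun s hs => le_min hs (by positivity))
    fun s _ => min_le_left _ _
  have hσi : Function.Injective σ := injective_radialMap q hψm hψ0
  have hσid : ∀ y ∈ ball q (ε / 2), σ y = y := by
    intro y hy
    refine radialMap_of_eq (min_eq_left ?_)
    rw [mem_ball, dist_eq_norm] at hy
    have : 0 ≤ ‖y - q‖ * a := by positivity
    linarith
  have hσq : σ q = q := radialMap_self q ψ
  have hσt : ∀ x ∈ closedBall (0 : E) R, 0 < τ x → σ (g x) ∈ e.target := by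
    intro x hx h0
    have hgx : g x ≠ q := fun hn => absurd ((hgq x (hDP x hx)).1 hn) (not_le.2 h0)
    refine htarget _ ?_ fun hn => hgx (hσi (hn.trans hσq.symm))
    have h1 : 0 < ‖g x - q‖ := norm_pos_iff.2 (sub_ne_zero.2 hgx)
    rw [mem_ball, dist_eq_norm, norm_radialMap_sub hgx (hψ0 _ h1).le]
    refine lt_of_le_of_lt (min_le_right _ _) ?_
    have h2 := (hM x hx).trans (le_abs_self M)
    nlinarith
  set G : E → E := fun x => if τ x ≤ 0 then x else e.symm (σ (g x)) with hG
  have hG1 : ∀ x, τ x ≤ 0 → G x = x := fun x hx => if_pos hx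
  have hG2 : ∀ x, 0 < τ x → G x = e.symm (σ (g x)) := fun x hx => if_neg (not_le.2 hx)
  have hGτ : ∀ x ∈ closedBall (0 : E) R, τ (G x) < b0 := by
    intro x hx
    by_cases h0 : τ x ≤ 0
    · rw [hG1 x h0]; linarith
    · have h1 := e.map_target (hσt x hx (not_le.1 h0))
      rw [hes] at h1
      rw [hG2 x (not_le.1 h0)]
      exact h1.2
  have hgG : ∀ x ∈ closedBall (0 : E) R, g (G x) = σ (g x) := by
    intro x hx
    by_cases h0 : τ x ≤ 0
    · rw [hG1 x h0, (hgq x (hDP x hx)).2 h0, hσq]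
    · rw [hG2 x (not_le.1 h0), ← he, e.right_inv (hσt x hx (not_le.1 h0))]
  set W : Set E := {x | τ x < b0} ∩ ({c P}ᶜ ∩ g ⁻¹' ball q (ε / 2)) with hW
  have hWo : IsOpen W := (isOpen_lt h.continuous continuous_const).inter
    (hgc.isOpen_inter_preimage isOpen_compl_singleton isOpen_ball)
  have hGW : ∀ x ∈ W, G x = x := by
    intro x hx
    by_cases h0 : τ x ≤ 0
    · exact hG1 x h0
    · rw [hG2 x (not_le.1 h0), hσid _ hx.2.2, ← he, e.left_inv]
      rw [hes]
      exact ⟨not_le.1 h0, hx.1⟩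
  have hXW : ∀ x, τ x ≤ 0 → x ∈ W := by
    intro x hx
    have hxP := hτP x (by linarith)
    refine ⟨show τ x < b0 by linarith, hxP, ?_⟩
    rw [mem_preimage, (hgq x hxP).2 hx]
    exact mem_ball_self (by positivity)
  refine ⟨G, ?_, ?_, fun x hx => (hGτ x hx).trans hb0b, ?_⟩
  · intro x hx
    refine ContinuousAt.continuousWithinAt ?_
    by_cases h0 : τ x ≤ 0
    · refine continuousAt_id.congr ?_
      filter_upwards [hWo.mem_nhds (hXW x h0)] with z hz
      exact (hGW z hz).symm
    · have h1 : ContinuousAt g x := hgc.continuousAt (isOpen_compl_singleton.mem_nhds (hDP x hx))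
      have h2 : ContinuousAt e.symm (σ (g x)) := e.symm.continuousAt (hσt x hx (not_le.1 h0))
      have h3 : ContinuousAt (fun z => e.symm (σ (g z))) x :=
        ContinuousAt.comp (f := fun z => σ (g z)) h2 (hσc.continuousAt.comp h1)
      refine h3.congr ?_
      filter_upwards [(isOpen_lt continuous_const h.continuous).mem_nhds (not_le.1 h0)] with z hz
      exact (hG2 z hz).symm
  · intro x hx x' hx' hxx'
    have h1 : σ (g x) = σ (g x') := by rw [← hgG x hx, ← hgG x' hx', hxx']
    rcases hgi x (hDP x hx) x' (hDP x' hx') (hσi h1) with h2 | ⟨h2, h3⟩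
    · exact h2
    · rwa [hG1 x h2, hG1 x' h3] at hxx'
  · obtain ⟨b', hb', hb'b, hb'W⟩ := h.exists_sublevel_subset hWo hXW hb hb1
    exact ⟨b', hb', hb'b, fun x hx => hGW x (hb'W x hx)⟩

end IsCollar
end Schoenflies

section Schoenflies
variable {E : Type*} [NormedAddCommGroup E] [InnerProductSpace ℝ E]

/-- A radial homeomorphism fixing everything outside a ball and shrinking a concentric ball. -/
theorem exists_radial_shrink {R₁ R₂ : ℝ} (h0 : 0 < R₁) (h12 : R₁ < R₂) {η : ℝ} (hη : 0 < η) :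
    ∃ σ : E → E, Continuous σ ∧ Function.Injective σ ∧ (∀ x, ‖σ x‖ ≤ ‖x‖) ∧
      (∀ x, R₂ ≤ ‖x‖ → σ x = x) ∧ ∀ x, ‖x‖ < R₁ → ‖σ x‖ < η := by
  set μ := min 1 (η / (2 * R₁)) with hμ
  have hμ0 : 0 < μ := lt_min one_pos (by positivity)
  have hμ1 : μ ≤ 1 := min_le_left _ _
  have hμR : μ * R₁ < η := by
    have h1 : μ * R₁ ≤ η / (2 * R₁) * R₁ := mul_le_mul_of_nonneg_right (min_le_right _ _) h0.le
    have h2 : η / (2 * R₁) * R₁ = η / 2 := by field_simp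
    linarith
  set a := R₂ / (R₂ - R₁) with ha
  have hd : 0 < R₂ - R₁ := by linarith
  have haR : a * (R₂ - R₁) = R₂ := by rw [ha]; field_simp
  have ha1 : 1 < a := by rw [ha, one_lt_div hd]; linarith
  set ψ : ℝ → ℝ := fun s => max (μ * s) (min s (a * (s - R₂) + R₂)) with hψ
  have hψc : Continuous ψ := by fun_prop
  have hψm : StrictMono ψ := fun s t hst => max_lt_max (by nlinarith) (min_lt_min hst (by nlinarith))
  have hψ0 : ∀ s, 0 < s → 0 < ψ s := fun s hs => lt_max_of_lt_left (by positivity)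
  have hψle : ∀ s, 0 ≤ s → ψ s ≤ s := fun s hs => max_le (by nlinarith) (min_le_left _ _)
  have hψ0' : ∀ s, 0 ≤ s → 0 ≤ ψ s := fun s hs => le_max_of_le_left (by positivity)
  have hnorm : ∀ x, x ≠ 0 → ‖radialMap (0 : E) ψ x‖ = ψ ‖x‖ := by
    intro x hx
    have := norm_radialMap_sub (q := (0 : E)) (ψ := ψ) hx (hψ0' _ (norm_nonneg _))
    rwa [sub_zero, sub_zero] at this
  refine ⟨radialMap 0 ψ, continuous_radialMap 0 hψc hψ0' hψle, injective_radialMap 0 hψm hψ0,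
    fun x => ?_, fun x hx => ?_, fun x hx => ?_⟩
  · rcases eq_or_ne x 0 with rfl | hx
    · rw [radialMap_self]
    · rw [hnorm x hx]
      exact hψle _ (norm_nonneg _)
  · refine radialMap_of_eq ?_
    rw [sub_zero]
    have h1 : ‖x‖ ≤ a * (‖x‖ - R₂) + R₂ := by nlinarith
    show max _ (min _ _) = _
    rw [min_eq_left h1, max_eq_right]
    nlinarith
  · rcases eq_or_ne x 0 with rfl | hx0
    · rwa [radialMap_self, norm_zero]
    · rw [hnorm x hx0]
      refine max_lt ?_ ((min_le_right _ _).trans_lt ?_)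
      · nlinarith
      · nlinarith

variable [FiniteDimensional ℝ E]
namespace IsCollar
variable {c : OpenPartialHomeomorph E E} {τ : E → ℝ} (h : IsCollar c τ)
include h

/-- The core can be shrunk to small size by an embedding supported in any given sublevel set. -/
theorem exists_shrink [Nontrivial E] {b : ℝ} (hb : 0 < b) (hb1 : b < 1) {δ : ℝ} (hδ : 0 < δ) :
    ∃ ρ : E → E, Continuous ρ ∧ Function.Injective ρ ∧ (∀ x, b ≤ τ x → ρ x = x) ∧
      ∃ b' > 0, b' < b ∧ ∃ w, ∀ x, τ x ≤ b' → dist (ρ x) w < δ := by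
  classical
  obtain ⟨P, hP, R₁, hR₁, hRP, hX⟩ := h.exists_ball
  set R := (R₁ + ‖c P‖) / 2 with hR
  have hR1 : R₁ < R := by linarith
  obtain ⟨G, hGc, hGi, hGτ, b₁, hb₁, hb₁b, hGid⟩ := h.exists_ball_embedding hP (R := R) (by linarith)
    (fun x hx => (hX x hx).trans hR1) hb hb1
  have hG0 : ContinuousAt G 0 := hGc.continuousAt (closedBall_mem_nhds 0 (by linarith))
  obtain ⟨η, hη, hGη⟩ := Metric.continuousAt_iff.1 hG0 δ hδ
  obtain ⟨σ, hσc, hσi, hσle, hσid, hση⟩ := exists_radial_shrink (E := E) hR₁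
    (show R₁ < (R₁ + R) / 2 by linarith) hη
  obtain ⟨e, hes, het, he⟩ := exists_openPartialHomeomorph (isOpen_ball (x := (0 : E)) (ε := R))
    (hGc.mono ball_subset_closedBall) (hGi.mono ball_subset_closedBall)
  have hσb : ∀ x ∈ ball (0 : E) R, σ x ∈ ball (0 : E) R := fun x hx =>
    mem_ball_zero_iff.2 ((hσle x).trans_lt (mem_ball_zero_iff.1 hx))
  have hsymm : ∀ x ∈ e.target, e.symm x ∈ ball (0 : E) R := fun x hx => hes ▸ e.map_target hx
  have hmapG : ∀ z ∈ ball (0 : E) R, G z ∈ e.target := fun z hz => het ▸ mem_image_of_mem G hz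
  set ρ : E → E := fun x => if x ∈ e.target then G (σ (e.symm x)) else x with hρ
  have hρ1 : ∀ x ∈ e.target, ρ x = G (σ (e.symm x)) := fun x hx => if_pos hx
  have hρ2 : ∀ x ∉ e.target, ρ x = x := fun x hx => if_neg hx
  have hρG : ∀ z ∈ ball (0 : E) R, ρ (G z) = G (σ z) := by
    intro z hz
    rw [hρ1 _ (hmapG z hz), ← he z, e.left_inv (hes ▸ hz)]
  have hρt : ∀ x ∈ e.target, ρ x ∈ e.target := fun x hx => by
    rw [hρ1 x hx]
    exact hmapG _ (hσb _ (hsymm x hx))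
  refine ⟨ρ, ?_, ?_, ?_, ?_⟩
  · rw [continuous_iff_continuousAt]
    intro x
    by_cases hx : x ∈ e.target
    · have h1 : ContinuousAt (fun x => G (σ (e.symm x))) x := by
        refine ContinuousAt.comp (f := fun x => σ (e.symm x)) ?_
          (hσc.continuousAt.comp (e.symm.continuousAt hx))
        exact hGc.continuousAt (mem_of_superset (isOpen_ball.mem_nhds (hσb _ (hsymm x hx)))
          ball_subset_closedBall)
      refine h1.congr ?_
      filter_upwards [e.open_target.mem_nhds hx] with z hz
      exact (hρ1 z hz).symm
    · have hK : IsClosed (G '' closedBall 0 ((R₁ + R) / 2)) :=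
        ((isCompact_closedBall _ _).image_of_continuousOn
          (hGc.mono (closedBall_subset_closedBall (by linarith)))).isClosed
      have hxK : x ∉ G '' closedBall 0 ((R₁ + R) / 2) := by
        rintro ⟨z, hz, rfl⟩
        exact hx (hmapG z (closedBall_subset_ball (by linarith) hz))
      refine continuousAt_id.congr ?_
      filter_upwards [hK.isOpen_compl.mem_nhds hxK] with z hz
      by_cases hzt : z ∈ e.target
      · rw [het] at hzt
        obtain ⟨v, hv, rfl⟩ := hzt
        rw [hρG v hv, hσid v, id]
        by_contra hlt
        exact hz ⟨v, mem_closedBall_zero_iff.2 (not_le.1 hlt).le, rfl⟩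
      · exact (hρ2 z hzt).symm
  · intro x x' hxx'
    by_cases hx : x ∈ e.target <;> by_cases hx' : x' ∈ e.target
    · rw [hρ1 x hx, hρ1 x' hx'] at hxx'
      have h1 := hGi (ball_subset_closedBall (hσb _ (hsymm x hx)))
        (ball_subset_closedBall (hσb _ (hsymm x' hx'))) hxx'
      exact e.symm.injOn hx hx' (hσi h1)
    · exact absurd (hρ2 x' hx' ▸ hxx' ▸ hρt x hx) hx'
    · exact absurd (hρ2 x hx ▸ hxx' ▸ hρt x' hx') hx
    · rwa [hρ2 x hx, hρ2 x' hx'] at hxx'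
  · intro x hx
    refine hρ2 x fun hxt => ?_
    rw [het] at hxt
    obtain ⟨z, hz, rfl⟩ := hxt
    exact absurd (hGτ z (ball_subset_closedBall hz)) (not_lt.2 hx)
  · obtain ⟨b', hb', hb'1, hb'U⟩ := h.exists_sublevel_subset isOpen_ball (U := ball 0 R₁)
      (fun x hx => mem_ball_zero_iff.2 (hX x hx)) hb₁ (hb₁b.trans hb1)
    refine ⟨b', hb', hb'1.trans hb₁b, G 0, fun x hx => ?_⟩
    have hxR := mem_ball_zero_iff.1 (hb'U x hx)
    have h1 : ρ x = G (σ x) := by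
      have := hρG x (mem_ball_zero_iff.2 (hxR.trans hR1))
      rwa [hGid x (hx.trans hb'1.le)] at this
    rw [h1]
    refine hGη ?_
    rw [dist_zero_right]
    exact hση x hxR

theorem exists_comp_shrink [Nontrivial E] {T : E → E} (hT : Continuous T)
    (hTi : Function.Injective T) {b : ℝ} (hb : 0 < b) (hb1 : b < 1) {ε : ℝ} (hε : 0 < ε) :
    ∃ T' : E → E, Continuous T' ∧ Function.Injective T' ∧ (∀ x, b ≤ τ x → T' x = T x) ∧
      (∀ x, τ x < b → ∃ x', τ x' < b ∧ T' x = T x') ∧ ∃ b' > 0, b' < b ∧ b' < ε ∧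
      ∀ x x', τ x ≤ b' → τ x' ≤ b' → dist (T' x) (T' x') < ε := by
  obtain ⟨δ, hδ, hTδ⟩ := Metric.uniformContinuousOn_iff.1
    ((h.isCompact b hb1).uniformContinuousOn_of_continuous hT.continuousOn) ε hε
  obtain ⟨ρ, hρ, hρi, hρid, b', hb', hb'b, w, hw⟩ := h.exists_shrink hb hb1 (half_pos hδ)
  have hρτ : ∀ x, τ x < b → τ (ρ x) < b := by
    intro x hx
    by_contra hn
    have h1 := hρi (hρid (ρ x) (not_lt.1 hn))
    rw [h1] at hn
    exact hn hx
  refine ⟨T ∘ ρ, hT.comp hρ, hTi.comp hρi, fun x hx => congrArg T (hρid x hx),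
    fun x hx => ⟨ρ x, hρτ x hx, rfl⟩, min b' (ε / 2), lt_min hb' (half_pos hε),
    (min_le_left _ _).trans_lt hb'b, (min_le_right _ _).trans_lt (half_lt_self hε), ?_⟩
  intro x x' hx hx'
  replace hx := hx.trans (min_le_left _ _)
  replace hx' := hx'.trans (min_le_left _ _)
  refine hTδ _ (hρτ x (hx.trans_lt hb'b)).le _ (hρτ x' (hx'.trans_lt hb'b)).le ?_
  have h1 := hw x hx
  have h2 := hw x' hx'
  have h3 := dist_triangle_right (ρ x) (ρ x') w
  linarith

/-- **Generalized Schoenflies theorem**: the embedding of a collared sphere extends to the ball. -/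
theorem exists_extension [Nontrivial E] :
    ∃ j : E → E, Continuous j ∧ Function.Injective j ∧ ∀ z, ‖z‖ = 1 → j z = c z := by
  classical
  let S := {p : (E → E) × ℝ // Continuous p.1 ∧ Function.Injective p.1 ∧ 0 < p.2 ∧ p.2 < 1}
  have step : ∀ (p : S) (k : ℕ), ∃ p' : S, (∀ x, p.1.2 ≤ τ x → p'.1.1 x = p.1.1 x) ∧
      (∀ x, τ x < p.1.2 → ∃ x', τ x' < p.1.2 ∧ p'.1.1 x = p.1.1 x') ∧ p'.1.2 < p.1.2 ∧
      p'.1.2 < 1 / ((k : ℝ) + 1) ∧ ∀ x x', τ x ≤ p'.1.2 → τ x' ≤ p'.1.2 →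
        dist (p'.1.1 x) (p'.1.1 x') < 1 / ((k : ℝ) + 1) := by
    rintro ⟨⟨T, b⟩, hT, hTi, hb, hb1⟩ k
    obtain ⟨T', h1, h2, h3, h4, b', h5, h6, h7, h8⟩ :=
      h.exists_comp_shrink hT hTi hb hb1 (Nat.one_div_pos_of_nat (α := ℝ) (n := k))
    exact ⟨⟨(T', b'), h1, h2, h5, lt_trans h6 hb1⟩, h3, h4, h6, h7, h8⟩
  choose next hnext using step
  let p : ℕ → S := fun n => Nat.rec
    ⟨(id, 1 / 2), continuous_id, Function.injective_id, by norm_num, by norm_num⟩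
    (fun k q => next q k) n
  let T : ℕ → E → E := fun k => (p k).1.1
  let b : ℕ → ℝ := fun k => (p k).1.2
  have hT : ∀ k, Continuous (T k) := fun k => (p k).2.1
  have hTi : ∀ k, Function.Injective (T k) := fun k => (p k).2.2.1
  have hb : ∀ k, 0 < b k := fun k => (p k).2.2.2.1
  have hb1 : ∀ k, b k < 1 := fun k => (p k).2.2.2.2
  have hTs : ∀ k x, b k ≤ τ x → T (k + 1) x = T k x := fun k => (hnext (p k) k).1
  have hTm : ∀ k x, τ x < b k → ∃ x', τ x' < b k ∧ T (k + 1) x = T k x' :=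
    fun k => (hnext (p k) k).2.1
  have hbs : ∀ k, b (k + 1) < b k := fun k => (hnext (p k) k).2.2.1
  have hbk : ∀ k, b (k + 1) < 1 / ((k : ℝ) + 1) := fun k => (hnext (p k) k).2.2.2.1
  have hTd : ∀ k x x', τ x ≤ b (k + 1) → τ x' ≤ b (k + 1) →
      dist (T (k + 1) x) (T (k + 1) x') < 1 / ((k : ℝ) + 1) := fun k => (hnext (p k) k).2.2.2.2
  have hanti : Antitone b := antitone_nat_of_succ_le fun k => (hbs k).le
  have hex : ∀ t > 0, ∃ k, b k < t := by
    intro t ht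
    obtain ⟨k, hk⟩ := exists_nat_one_div_lt ht
    exact ⟨k + 1, (hbk k).trans hk⟩
  have hstab : ∀ k m, k ≤ m → ∀ x, b k ≤ τ x → T m x = T k x := by
    intro k m hkm
    induction m, hkm using Nat.le_induction with
    | base => exact fun _ _ => rfl
    | succ m hm ih => exact fun x hx => (hTs m x ((hanti hm).trans hx)).trans (ih x hx)
  have hmap : ∀ k m, k ≤ m → ∀ x, τ x < b k → ∃ x', τ x' < b k ∧ T m x = T k x' := by
    intro k m hkm
    induction m, hkm using Nat.le_induction with
    | base => exact fun x hx => ⟨x, hx, rfl⟩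
    | succ m hm ih =>
      intro x hx
      by_cases hxm : b m ≤ τ x
      · rw [hTs m x hxm]
        exact ih x hx
      · obtain ⟨x', hx', he⟩ := hTm m x (not_le.1 hxm)
        rw [he]
        exact ih x' (hx'.trans_le (hanti hm))
  have hL : ∀ x, ∃ v, ∀ m, 0 < τ x → b m ≤ τ x → v = T m x := by
    intro x
    by_cases hx : 0 < τ x
    · obtain ⟨k, hk⟩ := hex _ hx
      refine ⟨T k x, fun m _ hm => ?_⟩
      rcases le_total k m with hkm | hkm
      · exact (hstab k m hkm x hk.le).symm
      · exact hstab m k hkm x hm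
    · exact ⟨x, fun m hx' => absurd hx' hx⟩
  choose L hL using hL
  obtain ⟨o, ho⟩ : (⋂ k, T k '' {x | τ x ≤ b k}).Nonempty := by
    refine IsCompact.nonempty_iInter_of_sequence_nonempty_isCompact_isClosed _ ?_ ?_ ?_ ?_
    · rintro k _ ⟨x, hx, rfl⟩
      obtain ⟨x', hx', he⟩ := hTm k x (lt_of_le_of_lt hx (hbs k))
      exact ⟨x', hx'.le, he.symm⟩
    · intro k
      obtain ⟨u, hu⟩ := exists_norm_eq E (hb k).le
      have hu0 : u ≠ 0 := norm_pos_iff.1 (hu ▸ hb k)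
      refine ⟨_, c u, ?_, rfl⟩
      show τ (c u) ≤ b k
      rw [h.height u hu0, hu, div_le_iff₀ (by linarith [hb k])]
      nlinarith [hb k]
    · exact ((h.isCompact _ (hb1 0)).image (hT 0))
    · exact fun k => ((h.isCompact _ (hb1 k)).image (hT k)).isClosed
  have ho' : ∀ k, ∃ x, τ x < b k ∧ T k x = o := by
    intro k
    obtain ⟨x, hx, he⟩ := mem_iInter.1 ho (k + 1)
    obtain ⟨x', hx', he'⟩ := hTm k x (lt_of_le_of_lt hx (hbs k))
    exact ⟨x', hx', he'.symm.trans he⟩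
  have hτ0 : ∀ z ≠ 0, 0 < τ (c z) := fun z hz => (h.apply_mem hz).1
  set j : E → E := fun z => if z = 0 then o else L (c z) with hj
  have hj0 : j 0 = o := if_pos rfl
  have hjT : ∀ z ≠ 0, ∀ m, b m ≤ τ (c z) → j z = T m (c z) := fun z hz m hm =>
    (if_neg hz).trans (hL _ m (hτ0 z hz) hm)
  refine ⟨j, ?_, ?_, ?_⟩
  · rw [continuous_iff_continuousAt]
    intro z
    rcases eq_or_ne z 0 with rfl | hz
    · rw [Metric.continuousAt_iff]
      intro ε hε
      obtain ⟨k, hk⟩ := exists_nat_one_div_lt hε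
      refine ⟨b (k + 1), hb (k + 1), fun {z} hz => ?_⟩
      rcases eq_or_ne z 0 with rfl | hz0
      · rwa [dist_self]
      · rw [dist_zero_right] at hz
        have hz0' := norm_pos_iff.2 hz0
        have hlt : τ (c z) < b (k + 1) := by
          rw [h.height z hz0, div_lt_iff₀ (by positivity)]
          nlinarith
        obtain ⟨m, hm⟩ := hex _ (hτ0 z hz0)
        have hkm : k + 1 ≤ m := by
          by_contra hn
          have := hanti (not_le.1 hn).le
          linarith
        obtain ⟨x', hx', he⟩ := hmap _ m hkm _ hlt
        obtain ⟨x, hx, hxo⟩ := ho' (k + 1)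
        rw [hj0, hjT z hz0 m hm.le, he, ← hxo]
        exact (hTd k _ _ hx'.le hx.le).trans hk
    · obtain ⟨m, hm⟩ := hex _ (hτ0 z hz)
      have hcz : ContinuousAt c z := h.continuousOn.continuousAt (isOpen_compl_singleton.mem_nhds hz)
      refine ((hT m).continuousAt.comp hcz).congr ?_
      filter_upwards [isOpen_compl_singleton.mem_nhds hz,
        (h.continuous.continuousAt.comp hcz).eventually (lt_mem_nhds hm)] with v hv hvm
      exact (hjT v hv m (le_of_lt hvm)).symm
  · have hne : ∀ z ≠ 0, j z ≠ o := by
      intro z hz he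
      obtain ⟨m, hm⟩ := hex _ (hτ0 z hz)
      obtain ⟨x, hx, hxo⟩ := ho' m
      rw [hjT z hz m hm.le, ← hxo] at he
      have := hTi m he
      rw [← this] at hx
      linarith
    intro z z' he
    rcases eq_or_ne z 0 with rfl | hz <;> rcases eq_or_ne z' 0 with rfl | hz'
    · rfl
    · exact absurd (he.symm.trans hj0) (hne z' hz')
    · exact absurd (he.trans hj0) (hne z hz)
    · obtain ⟨m, hm⟩ := hex _ (lt_min (hτ0 z hz) (hτ0 z' hz'))
      rw [hjT z hz m (hm.le.trans (min_le_left _ _)),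
        hjT z' hz' m (hm.le.trans (min_le_right _ _))] at he
      exact h.injOn hz hz' (hTi m he)
  · intro z hz
    have hz0 : z ≠ 0 := norm_pos_iff.1 (by rw [hz]; exact one_pos)
    refine hjT z hz0 0 ?_
    rw [h.height z hz0, hz]
    show (1 / 2 : ℝ) ≤ _
    norm_num

end IsCollar
end Schoenflies

theorem IsPreconnected.exists_int_eq {X : Type*} [TopologicalSpace X] {S : Set X}
    (hS : IsPreconnected S) {f : X → ℝ} (hf : ContinuousOn f S)
    (hZ : ∀ x ∈ S, ∃ n : ℤ, f x = n) : ∃ n : ℤ, ∀ x ∈ S, f x = n := by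
  have hd : IsDiscrete (range ((↑) : ℤ → ℝ)) :=
    ⟨Int.isClosedEmbedding_coe_real.isEmbedding.toHomeomorph.symm.isEmbedding.discreteTopology⟩
  obtain ⟨_, ⟨n, rfl⟩, h⟩ := hS.eqOn_const_of_mapsTo hd hf
    (fun x hx => (hZ x hx).imp fun _ h => h.symm) (range_nonempty _)
  exact ⟨n, h⟩

theorem AddCircle.exists_int_of_coe_eq {x y : ℝ} (h : (x : AddCircle (1 : ℝ)) = y) :
    ∃ n : ℤ, x - y = n := by
  obtain ⟨n, hn⟩ := (AddCircle.coe_eq_zero_iff (1 : ℝ) (x := x - y)).1 (by simp [h])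
  exact ⟨n, by simpa using hn.symm⟩

section Collar
variable {E : Type*} [NormedAddCommGroup E] [InnerProductSpace ℝ E]

theorem isPreconnected_compl_closedBall_zero (hd : 1 < Module.rank ℝ E) {M : ℝ} (hM : 0 ≤ M) :
    IsPreconnected {x : E | M < ‖x‖} := by
  have : {x : E | M < ‖x‖} = (fun p : ℝ × E => p.1 • p.2) '' (Ioi M ×ˢ sphere (0 : E) 1) := by
    ext x
    constructor
    · intro hx
      have hx' : M < ‖x‖ := hx
      have h0 : ‖x‖ ≠ 0 := by linarith
      refine ⟨(‖x‖, ‖x‖⁻¹ • x), ⟨hx, ?_⟩, ?_⟩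
      · rw [mem_sphere_zero_iff_norm, norm_smul, norm_inv, norm_norm, inv_mul_cancel₀ h0]
      · simp only [smul_smul, mul_inv_cancel₀ h0, one_smul]
    · rintro ⟨⟨r, u⟩, ⟨hr, hu⟩, rfl⟩
      have hr' : M < r := hr
      show M < ‖r • u‖
      rw [norm_smul, mem_sphere_zero_iff_norm.1 hu, mul_one, Real.norm_of_nonneg (by linarith)]
      exact hr
  rw [this]
  exact (isPreconnected_Ioi.prod (isPreconnected_sphere hd 0 1)).image _ (by fun_prop)

variable [FiniteDimensional ℝ E] {f : E × ℝ → E} {ε : ℝ}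

/-- A bicollar of a sphere, in polar coordinates. -/
theorem exists_polar (hε : 0 < ε) (hf : ContinuousOn f (sphere (0 : E) 1 ×ˢ Icc (-ε) ε))
    (hfi : InjOn f (sphere (0 : E) 1 ×ˢ Icc (-ε) ε)) :
    ∃ c : OpenPartialHomeomorph E E, c.source = {0}ᶜ ∧
      c.target = f '' (sphere (0 : E) 1 ×ˢ Ioo (-ε) ε) ∧
      ∀ z ≠ 0, ‖z‖⁻¹ • z ∈ sphere (0 : E) 1 ∧ ε * ((‖z‖ - 1) / (1 + ‖z‖)) ∈ Ioo (-ε) ε ∧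
        c z = f (‖z‖⁻¹ • z, ε * ((‖z‖ - 1) / (1 + ‖z‖))) := by
  set k : E → E × ℝ := fun z => (‖z‖⁻¹ • z, ε * ((‖z‖ - 1) / (1 + ‖z‖))) with hk
  have hkc : ContinuousOn k {0}ᶜ := by
    refine ContinuousOn.prodMk ((ContinuousOn.inv₀ (by fun_prop) fun z hz =>
      norm_ne_zero_iff.2 hz).smul continuousOn_id) (continuousOn_const.mul
      (ContinuousOn.div (by fun_prop) (by fun_prop) fun z _ => ?_))
    positivity
  have hk1 : ∀ z ≠ 0, ‖z‖⁻¹ • z ∈ sphere (0 : E) 1 := by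
    intro z hz
    rw [mem_sphere_zero_iff_norm, norm_smul, norm_inv, norm_norm,
      inv_mul_cancel₀ (norm_ne_zero_iff.2 hz)]
  have hk2 : ∀ z : E, z ≠ 0 → ε * ((‖z‖ - 1) / (1 + ‖z‖)) ∈ Ioo (-ε) ε := by
    intro z hz
    have hz0 := norm_pos_iff.2 hz
    have h1 : (‖z‖ - 1) / (1 + ‖z‖) < 1 := by rw [div_lt_one (by positivity)]; linarith
    have h2 : -1 < (‖z‖ - 1) / (1 + ‖z‖) := by rw [lt_div_iff₀ (by positivity)]; linarith
    constructor <;> nlinarith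
  have hki : InjOn k {0}ᶜ := by
    intro z hz z' hz' he
    obtain ⟨h1, h2⟩ := Prod.mk.inj he
    have hz0 := norm_pos_iff.2 hz
    have hz0' := norm_pos_iff.2 hz'
    have h3 : ‖z‖ = ‖z'‖ := by
      have h4 := mul_left_cancel₀ hε.ne' h2
      rw [div_eq_div_iff (by positivity) (by positivity)] at h4
      nlinarith
    rw [h3] at h1
    exact smul_right_injective E (inv_ne_zero hz0'.ne') h1
  have hkm : MapsTo k {0}ᶜ (sphere (0 : E) 1 ×ˢ Icc (-ε) ε) := fun z hz =>
    ⟨hk1 z hz, Ioo_subset_Icc_self (hk2 z hz)⟩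
  have hkimg : k '' {0}ᶜ = sphere (0 : E) 1 ×ˢ Ioo (-ε) ε := by
    refine Subset.antisymm ?_ ?_
    · rintro _ ⟨z, hz, rfl⟩
      exact ⟨hk1 z hz, hk2 z hz⟩
    · rintro ⟨u, t⟩ ⟨hu, ht1, ht2⟩
      have hu1 : ‖u‖ = 1 := mem_sphere_zero_iff_norm.1 hu
      have ht1' : -ε < t := ht1
      have ht2' : t < ε := ht2
      have hr : 0 < (ε + t) / (ε - t) := div_pos (by linarith) (by linarith)
      have hn : ‖((ε + t) / (ε - t)) • u‖ = (ε + t) / (ε - t) := by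
        rw [norm_smul, hu1, mul_one, Real.norm_of_nonneg hr.le]
      refine ⟨((ε + t) / (ε - t)) • u, ?_, ?_⟩
      · exact norm_pos_iff.1 (hr.trans_eq hn.symm)
      · rw [hk]
        simp only [hn, smul_smul, inv_mul_cancel₀ hr.ne', one_smul]
        have h1 : ε - t ≠ 0 := by linarith
        congr 1
        have h2 : 1 + (ε + t) / (ε - t) = 2 * ε / (ε - t) := by field_simp; ring
        have h3 : (ε + t) / (ε - t) - 1 = 2 * t / (ε - t) := by field_simp; ring
        rw [h2, h3]
        field_simp
  obtain ⟨c, hs, ht, hc⟩ := exists_openPartialHomeomorph (isOpen_compl_singleton (x := (0 : E)))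
    (hf.comp hkc hkm) (hfi.comp hki hkm)
  exact ⟨c, hs, by rw [ht, image_comp, hkimg], fun z hz => ⟨hk1 z hz, hk2 z hz, hc z⟩⟩

/-- The winding coordinate of a bicollar, lifted to the real line. -/
theorem exists_height_of_bicollar (hd : 1 < Module.rank ℝ E) (hε : 0 < ε)
    (hf : ContinuousOn f (sphere (0 : E) 1 ×ˢ Icc (-ε) ε))
    (hfi : InjOn f (sphere (0 : E) 1 ×ˢ Icc (-ε) ε)) :
    ∃ θ : E → ℝ, Continuous θ ∧
      (∀ u ∈ sphere (0 : E) 1, ∀ t ∈ Icc (-ε) ε, θ (f (u, t)) = t / (2 * ε)) ∧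
      (∀ x ∉ f '' (sphere (0 : E) 1 ×ˢ Ioo (-ε) ε), ∃ n : ℤ, θ x = n + 1 / 2) ∧
      ∃ (M : ℝ) (m : ℤ), ∀ x, M < ‖x‖ → θ x = m + 1 / 2 := by
  classical
  set D := sphere (0 : E) 1 ×ˢ Icc (-ε) ε with hD
  set U := f '' (sphere (0 : E) 1 ×ˢ Ioo (-ε) ε) with hU
  have hDc : IsCompact D := (isCompact_sphere 0 1).prod isCompact_Icc
  have hKc : IsCompact (f '' D) := hDc.image_of_continuousOn hf
  have hUK : U ⊆ f '' D := image_mono (prod_mono_right Ioo_subset_Icc_self)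
  have hUo : IsOpen U := by
    obtain ⟨c, -, hc, -⟩ := exists_polar hε hf hfi
    rw [hU, ← hc]
    exact c.open_target
  obtain ⟨T, hTc, hT⟩ : ∃ T : E → ℝ, Continuous T ∧ ∀ p ∈ D, T (f p) = p.2 / (2 * ε) := by
    have : CompactSpace D := isCompact_iff_compactSpace.1 hDc
    have he : IsClosedEmbedding (D.domRestrict f) :=
      (continuousOn_iff_continuous_domRestrict.1 hf).isClosedEmbedding hfi.injective
    obtain ⟨T, hT⟩ := ContinuousMap.exists_extension he
      ⟨fun p : D => p.1.2 / (2 * ε), by fun_prop⟩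
    exact ⟨T, T.continuous, fun p hp => congrArg (fun F => F ⟨p, hp⟩) hT⟩
  have hUT : ∀ p ∈ D, f p ∉ U → ((T (f p) : ℝ) : AddCircle (1 : ℝ)) = ((1 / 2 : ℝ) : AddCircle (1 : ℝ)) := by
    intro p hp hpU
    rw [hT p hp]
    have h1 : p.2 = ε ∨ p.2 = -ε := by
      by_contra hn
      push Not at hn
      exact hpU ⟨p, ⟨hp.1, lt_of_le_of_ne hp.2.1 hn.2.symm, lt_of_le_of_ne hp.2.2 hn.1⟩, rfl⟩
    rcases h1 with h1 | h1
    · rw [h1]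
      congr 1
      field_simp
    · rw [h1]
      have h2 : -ε / (2 * ε) = 1 / 2 - 1 := by field_simp; norm_num
      rw [h2, AddCircle.coe_sub, AddCircle.coe_period, sub_zero]
  set g : E → AddCircle (1 : ℝ) := fun x => if x ∈ U then ((T x : ℝ) : AddCircle (1 : ℝ)) else
    ((1 / 2 : ℝ) : AddCircle (1 : ℝ)) with hg
  have hgK : ∀ x ∈ f '' D, g x = ((T x : ℝ) : AddCircle (1 : ℝ)) := by
    rintro _ ⟨p, hp, rfl⟩
    by_cases hpU : f p ∈ U
    · exact if_pos hpU
    · exact (if_neg hpU).trans (hUT p hp hpU).symm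
  have hgU : ∀ x ∉ U, g x = ((1 / 2 : ℝ) : AddCircle (1 : ℝ)) := fun x hx => if_neg hx
  have hgc : Continuous g := by
    rw [← continuousOn_univ]
    have : (univ : Set E) = f '' D ∪ Uᶜ := by
      refine (eq_univ_of_forall fun x => ?_).symm
      by_cases hx : x ∈ U
      · exact Or.inl (hUK hx)
      · exact Or.inr hx
    rw [this]
    refine ContinuousOn.union_of_isClosed ?_ ?_ hKc.isClosed hUo.isClosed_compl
    · exact ((AddCircle.continuous_mk' 1).comp hTc).continuousOn.congr hgK
    · exact continuousOn_const.congr hgU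
  obtain ⟨e₀, he₀⟩ := QuotientAddGroup.mk_surjective (g 0)
  obtain ⟨Θ, ⟨-, hΘ⟩, -⟩ := (AddCircle.isCoveringMap_coe (1 : ℝ)).existsUnique_continuousMap_lifts
    ⟨g, hgc⟩ (0 : E) e₀ he₀
  replace hΘ : ∀ x, ((Θ x : ℝ) : AddCircle (1 : ℝ)) = g x := fun x => congrFun hΘ x
  obtain ⟨n, hn⟩ : ∃ n : ℤ, ∀ p ∈ D, Θ (f p) - p.2 / (2 * ε) = n := by
    refine IsPreconnected.exists_int_eq ((isPreconnected_sphere hd 0 1).prod isPreconnected_Icc)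
      ?_ fun p hp => ?_
    · exact (Θ.continuous.comp_continuousOn hf).sub (by fun_prop)
    · refine AddCircle.exists_int_of_coe_eq ?_
      rw [hΘ, hgK _ (mem_image_of_mem f hp), hT p hp]
  have hout : ∀ x ∉ U, ∃ k : ℤ, Θ x - 1 / 2 = k := fun x hx =>
    AddCircle.exists_int_of_coe_eq ((hΘ x).trans (hgU x hx))
  refine ⟨fun x => Θ x - n, by fun_prop, ?_, ?_, ?_⟩
  · intro u hu t ht
    have := hn (u, t) ⟨hu, ht⟩
    simp only at this ⊢
    linarith
  · intro x hx
    obtain ⟨k, hk⟩ := hout x hx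
    exact ⟨k - n, by push_cast; linarith⟩
  · obtain ⟨M, hM⟩ := hKc.isBounded.exists_norm_le
    have hMU : ∀ x : E, |M| < ‖x‖ → x ∉ U := fun x hx hxU => by
      have := hM x (hUK hxU)
      linarith [le_abs_self M]
    obtain ⟨m, hm⟩ := (isPreconnected_compl_closedBall_zero hd (abs_nonneg M)).exists_int_eq
      (f := fun x => Θ x - 1 / 2) (by fun_prop) fun x hx => hout x (hMU x hx)
    refine ⟨|M|, m - n, fun x hx => ?_⟩
    have := hm x hx
    push_cast
    linarith

theorem exists_isCollar_of_height (hε : 0 < ε)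
    (hf : ContinuousOn f (sphere (0 : E) 1 ×ˢ Icc (-ε) ε))
    (hfi : InjOn f (sphere (0 : E) 1 ×ˢ Icc (-ε) ε)) {θ : E → ℝ} (hθ : Continuous θ)
    (hθf : ∀ u ∈ sphere (0 : E) 1, ∀ t ∈ Icc (-ε) ε, θ (f (u, t)) = t / (2 * ε))
    (hθU : ∀ x ∉ f '' (sphere (0 : E) 1 ×ˢ Ioo (-ε) ε), ∃ n : ℤ, θ x = n + 1 / 2)
    {M : ℝ} (hM : ∀ x, M < ‖x‖ → 1 / 2 ≤ θ x) :
    ∃ (c : OpenPartialHomeomorph E E) (τ : E → ℝ), IsCollar c τ ∧ ∀ z, ‖z‖ = 1 → c z = f (z, 0) := by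
  obtain ⟨c, hs, ht, hc⟩ := exists_polar hε hf hfi
  refine ⟨c, fun x => θ x + 1 / 2, ⟨hs, ?_, ?_, by fun_prop, ?_⟩, ?_⟩
  · rw [ht]
    ext x
    constructor
    · rintro ⟨⟨u, t⟩, ⟨hu, ht'⟩, rfl⟩
      have h1 := hθf u hu t (Ioo_subset_Icc_self ht')
      have h2 : -ε < t := ht'.1
      have h3 : t < ε := ht'.2
      have h4 : -(1 / 2) < t / (2 * ε) := by rw [lt_div_iff₀ (by positivity)]; linarith
      have h5 : t / (2 * ε) < 1 / 2 := by rw [div_lt_iff₀ (by positivity)]; linarith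
      constructor
      · show 0 < θ (f (u, t)) + 1 / 2
        linarith
      · show θ (f (u, t)) + 1 / 2 < 1
        linarith
    · rintro ⟨h1, h2⟩
      by_contra hx
      obtain ⟨n, hn⟩ := hθU x hx
      rw [hn] at h1 h2
      have h3 : (-1 : ℝ) < n := by linarith
      have h4 : (n : ℝ) < 0 := by linarith
      have h5 : (-1 : ℤ) < n := by exact_mod_cast h3
      have h6 : n < 0 := by exact_mod_cast h4
      omega
  · intro z hz
    obtain ⟨h1, h2, h3⟩ := hc z hz
    have hz0 := norm_pos_iff.2 hz
    rw [h3, hθf _ h1 _ (Ioo_subset_Icc_self h2)]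
    field_simp
    ring
  · intro b hb
    refine isCompact_of_isClosed_isBounded (isClosed_le (by fun_prop) continuous_const)
      (isBounded_iff_forall_norm_le.2 ⟨M, fun x hx => ?_⟩)
    by_contra hn
    have h1 := hM x (not_le.1 hn)
    have h2 : θ x + 1 / 2 ≤ b := hx
    linarith
  · intro z hz
    have hz0 : z ≠ 0 := norm_pos_iff.1 (by rw [hz]; exact one_pos)
    rw [(hc z hz0).2.2, hz]
    simp

/-- Every bicollared sphere is, after possibly reversing the collar, collared in the sense of
`IsCollar`. -/
theorem exists_isCollar (hd : 1 < Module.rank ℝ E) (hε : 0 < ε)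
    (hf : ContinuousOn f (sphere (0 : E) 1 ×ˢ Icc (-ε) ε))
    (hfi : InjOn f (sphere (0 : E) 1 ×ˢ Icc (-ε) ε)) :
    ∃ (c : OpenPartialHomeomorph E E) (τ : E → ℝ), IsCollar c τ ∧ ∀ z, ‖z‖ = 1 → c z = f (z, 0) := by
  obtain ⟨θ, hθ, hθf, hθU, M, m, hm⟩ := exists_height_of_bicollar hd hε hf hfi
  rcases le_or_gt 0 m with h0 | h0
  · refine exists_isCollar_of_height hε hf hfi hθ hθf hθU (M := M) fun x hx => ?_
    rw [hm x hx]
    have : (0 : ℝ) ≤ m := by exact_mod_cast h0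
    linarith
  · have hneg : MapsTo (fun p : E × ℝ => (p.1, -p.2)) (sphere (0 : E) 1 ×ˢ Icc (-ε) ε)
        (sphere (0 : E) 1 ×ˢ Icc (-ε) ε) := fun p hp =>
      ⟨hp.1, neg_le_neg hp.2.2, neg_le.1 hp.2.1⟩
    have h := exists_isCollar_of_height (f := fun p => f (p.1, -p.2)) hε
      (hf.comp (by fun_prop) hneg) (hfi.comp (fun p _ q _ h => by
        obtain ⟨h1, h2⟩ := Prod.mk.inj h
        exact Prod.ext h1 (neg_injective h2)) hneg) hθ.neg (M := M)
    refine (h ?_ ?_ ?_).imp fun c => Exists.imp fun τ hc =>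
      ⟨hc.1, fun z hz => by rw [hc.2 z hz, neg_zero]⟩
    · intro u hu t ht
      have := hθf u hu (-t) ⟨neg_le_neg ht.2, neg_le.1 ht.1⟩
      rw [Pi.neg_apply, this]
      ring
    · intro x hx
      obtain ⟨n, hn⟩ := hθU x fun hxU => hx <| by
        obtain ⟨⟨u, t⟩, ⟨hu, ht⟩, rfl⟩ := hxU
        exact ⟨(u, -t), ⟨hu, neg_lt_neg ht.2, neg_lt.1 ht.1⟩, by simp⟩
      refine ⟨-n - 1, ?_⟩
      rw [Pi.neg_apply, hn]
      push_cast
      ring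
    · intro x hx
      rw [Pi.neg_apply, hm x hx]
      have : (m : ℝ) ≤ -1 := by exact_mod_cast Int.le_sub_one_of_lt h0
      linarith

end Collar

section Outward
variable {E : Type*} [NormedAddCommGroup E] [InnerProductSpace ℝ E]

/-- `v` points uniformly out of `Ω` near `p`: small backward steps along directions close to `v`
from points of the closure of `Ω` close to `p` lead into `Ω`. -/
def IsOutward (Ω : Set E) (p v : E) : Prop :=
  ∃ δ > 0, ∀ q ∈ closure Ω, ‖q - p‖ < δ → ∀ w, ‖w - v‖ < δ → ∀ s : ℝ, 0 < s → s < δ → q - s • w ∈ Ω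

namespace IsOutward
variable {Ω : Set E} {p v v' : E}

theorem add (h : IsOutward Ω p v) (h' : IsOutward Ω p v') : IsOutward Ω p (v + v') := by
  obtain ⟨δ, hδ, H⟩ := h
  obtain ⟨δ', hδ', H'⟩ := h'
  set a := δ' / (2 * (‖v‖ + 1)) with ha
  have ha0 : 0 < a := by positivity
  have hav : a * (‖v‖ + 1) = δ' / 2 := by rw [ha]; field_simp
  refine ⟨min δ (min (δ' / 2) a), by positivity, fun q hq hqp w hw s hs0 hs => ?_⟩
  simp only [lt_min_iff] at hqp hw hs
  have h1 : q - s • v ∈ Ω := H q hq hqp.1 v (by simpa using hδ) s hs0 hs.1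
  have h2 : ‖q - s • v - p‖ < δ' := by
    have h3 : q - s • v - p = (q - p) - s • v := by abel
    have h4 := norm_sub_le (q - p) (s • v)
    rw [norm_smul, Real.norm_of_nonneg hs0.le] at h4
    rw [h3]
    nlinarith [norm_nonneg v, hqp.2.1, hs.2.2]
  have h5 := H' _ (subset_closure h1) h2 (w - v)
    (by rw [sub_sub]; linarith [hw.2.1]) s hs0 (by linarith [hs.2.1])
  rwa [smul_sub, sub_sub, add_sub_cancel] at h5

theorem smul (h : IsOutward Ω p v) {a : ℝ} (ha : 0 < a) : IsOutward Ω p (a • v) := by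
  obtain ⟨δ, hδ, H⟩ := h
  refine ⟨min δ (min (a * δ) (δ / a)), by positivity, fun q hq hqp w hw s hs0 hs => ?_⟩
  simp only [lt_min_iff] at hqp hw hs
  have h1 : ‖a⁻¹ • w - v‖ < δ := by
    have h2 : a⁻¹ • w - v = a⁻¹ • (w - a • v) := by
      rw [smul_sub, smul_smul, inv_mul_cancel₀ ha.ne', one_smul]
    rw [h2, norm_smul, norm_inv, Real.norm_of_nonneg ha.le, inv_mul_lt_iff₀ ha]
    exact hw.2.1
  have h3 := H q hq hqp.1 _ h1 (s * a) (by positivity) ((lt_div_iff₀ ha).1 hs.2.2)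
  rwa [smul_smul, mul_assoc, mul_inv_cancel₀ ha.ne', mul_one] at h3

theorem exists_ball (h : IsOutward Ω p v) : ∃ r > 0, ∀ x ∈ ball p r, IsOutward Ω x v := by
  obtain ⟨δ, hδ, H⟩ := h
  refine ⟨δ / 2, by positivity, fun x hx => ⟨δ / 2, by positivity, fun q hq hqx w hw s hs0 hs => ?_⟩⟩
  refine H q hq ?_ w (by linarith) s hs0 (by linarith)
  rw [mem_ball, dist_eq_norm] at hx
  have := norm_sub_le_norm_sub_add_norm_sub q x p
  linarith

theorem sum_smul {ι : Type*} (t : Finset ι) {a : ι → ℝ} {ν : ι → E}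
    (h0 : ∀ i ∈ t, 0 ≤ a i) (h : ∀ i ∈ t, 0 < a i → IsOutward Ω p (ν i))
    (hpos : ∃ i ∈ t, 0 < a i) : IsOutward Ω p (∑ i ∈ t, a i • ν i) := by
  classical
  have key : (∀ i ∈ t, a i = 0) ∨ IsOutward Ω p (∑ i ∈ t, a i • ν i) := by
    clear hpos
    induction t using Finset.induction_on with
    | empty => left; simp
    | insert i t hi ih =>
      have ih' := ih (fun j hj => h0 j (Finset.mem_insert_of_mem hj))
        fun j hj => h j (Finset.mem_insert_of_mem hj)
      have hai := h0 i (Finset.mem_insert_self i t)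
      rw [Finset.sum_insert hi]
      rcases hai.eq_or_lt with hz | hp
      · rw [← hz, zero_smul, zero_add]
        refine ih'.imp (fun hall j hj => ?_) id
        rcases Finset.mem_insert.1 hj with rfl | hj
        · exact hz.symm
        · exact hall j hj
      · right
        have hν := (h i (Finset.mem_insert_self i t) hp).smul hp
        rcases ih' with hall | hgood
        · rwa [Finset.sum_eq_zero fun j hj => by rw [hall j hj, zero_smul], add_zero]
        · exact hν.add hgood
  obtain ⟨i, hi, hai⟩ := hpos
  exact key.resolve_left fun hall => hai.ne' (hall i hi)

/-- A boundary point with an outward direction is not interior to the closure. -/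
theorem notMem_interior_closure (hΩ : IsOpen Ω) (h : IsOutward Ω p v) (hp : p ∈ frontier Ω) :
    p ∉ interior (closure Ω) := by
  intro hi
  obtain ⟨δ, hδ, H⟩ := h
  have hc : Tendsto (fun s : ℝ => p + s • v) (𝓝[>] 0) (𝓝 p) :=
    ((by fun_prop : Continuous fun s : ℝ => p + s • v).tendsto' 0 p (by simp)).mono_left
      nhdsWithin_le_nhds
  obtain ⟨s, ⟨⟨hs1, hs2⟩, hs3⟩, hs0⟩ := (((hc.eventually (isOpen_interior.mem_nhds hi)).and
    (hc.eventually (ball_mem_nhds p hδ))).and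
    (mem_nhdsWithin_of_mem_nhds (gt_mem_nhds hδ)) |>.and self_mem_nhdsWithin).exists
  have := H _ (interior_subset hs1) (by rwa [dist_eq_norm] at hs2) v (by simpa using hδ)
    s hs0 hs3
  rw [add_sub_cancel_right] at this
  rw [hΩ.frontier_eq] at hp
  exact hp.2 this

/-- Displacing the boundary along a Lipschitz field of outward directions is locally injective. -/
theorem exists_injOn {Ω : Set E} (hΩ : IsOpen Ω) {v : E → E} {C : ℝ}
    (hv : ∀ x x', ‖v x - v x'‖ ≤ C * ‖x - x'‖) {p : E} (h : IsOutward Ω p (v p)) :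
    ∃ η > 0, InjOn (fun z : E × ℝ => z.1 + z.2 • v z.1) ((frontier Ω ∩ ball p η) ×ˢ Ioo (-η) η) := by
  obtain ⟨δ, hδ, H⟩ := h
  set B := ‖v p‖ + 1 with hB
  have hB1 : 1 ≤ B := by linarith [norm_nonneg (v p)]
  set C' := |C| + 1 with hC'
  have hC'1 : 1 ≤ C' := by linarith [abs_nonneg C]
  have hv' : ∀ x x', ‖v x - v x'‖ ≤ C' * ‖x - x'‖ := fun x x' =>
    (hv x x').trans (mul_le_mul_of_nonneg_right (by linarith [le_abs_self C]) (norm_nonneg _))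
  set η := min (δ / 2) (min (1 / (2 * C')) (δ / (8 * C' * B))) with hη
  have hη0 : 0 < η := by positivity
  have hη1 : η ≤ δ / 2 := min_le_left _ _
  have hη2 : C' * η ≤ 1 / 2 := by
    have : η ≤ 1 / (2 * C') := (min_le_right _ _).trans (min_le_left _ _)
    rw [le_div_iff₀ (by positivity)] at this
    linarith
  have hη3 : C' * B * η ≤ δ / 8 := by
    have : η ≤ δ / (8 * C' * B) := (min_le_right _ _).trans (min_le_right _ _)
    rw [le_div_iff₀ (by positivity)] at this
    linarith
  have key : ∀ x ∈ frontier Ω ∩ ball p η, ∀ x' ∈ frontier Ω ∩ ball p η, ∀ t ∈ Ioo (-η) η,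
      ∀ t' ∈ Ioo (-η) η, t ≤ t' → x + t • v x = x' + t' • v x' → x = x' ∧ t = t' := by
    rintro x ⟨hx, hxp⟩ x' ⟨hx', hxp'⟩ t ht t' ht' htt he
    rw [mem_ball, dist_eq_norm] at hxp hxp'
    have htη : |t| < η := abs_lt.2 ht
    have hvx' : ‖v x' - v p‖ ≤ C' * η := (hv' _ _).trans (by gcongr)
    have hvB : ‖v x'‖ ≤ B := by
      have := norm_le_norm_add_norm_sub' (v x') (v p)
      linarith
    have h1 : x - x' = (t' - t) • v x' + t • (v x' - v x) := by
      have h0 : x - x' - ((t' - t) • v x' + t • (v x' - v x))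
          = (x + t • v x) - (x' + t' • v x') := by module
      rw [he, sub_self] at h0
      exact sub_eq_zero.1 h0
    have h2 : ‖x - x'‖ ≤ (t' - t) * B + |t| * (C' * ‖x - x'‖) := by
      calc ‖x - x'‖ ≤ ‖(t' - t) • v x'‖ + ‖t • (v x' - v x)‖ := by
            conv_lhs => rw [h1]
            exact norm_add_le _ _
        _ ≤ _ := by
            rw [norm_smul, norm_smul, Real.norm_of_nonneg (by linarith : 0 ≤ t' - t), Real.norm_eq_abs,
              norm_sub_rev (v x')]
            have := hv' x x'
            have : 0 ≤ t' - t := by linarith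
            gcongr
    have h3 : ‖x - x'‖ ≤ 2 * ((t' - t) * B) := by
      have h4 : |t| * (C' * ‖x - x'‖) ≤ 1 / 2 * ‖x - x'‖ := by
        rw [← mul_assoc]
        refine mul_le_mul_of_nonneg_right ?_ (norm_nonneg _)
        nlinarith
      linarith
    rcases htt.eq_or_lt with heq | hlt
    · refine ⟨?_, heq⟩
      rw [heq, sub_self, zero_mul, mul_zero] at h3
      exact sub_eq_zero.1 (norm_le_zero_iff.1 h3)
    · exfalso
      have hd : 0 < t' - t := by linarith
      have h5 := H x (frontier_subset_closure hx) (by linarith)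
        (v x' + (t / (t' - t)) • (v x' - v x)) ?_ (t' - t) hd ?_
      · rw [smul_add, smul_smul, mul_div_cancel₀ _ hd.ne', ← h1, sub_sub_cancel] at h5
        rw [hΩ.frontier_eq] at hx'
        exact hx'.2 h5
      · have h6 : ‖(t / (t' - t)) • (v x' - v x)‖ ≤ 2 * (C' * B * η) := by
          rw [norm_smul, norm_div, Real.norm_of_nonneg hd.le, Real.norm_eq_abs, div_mul_eq_mul_div,
            div_le_iff₀ hd, norm_sub_rev]
          calc |t| * ‖v x - v x'‖ ≤ η * (C' * (2 * ((t' - t) * B))) := by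
                have := hv' x x'
                gcongr
                exact this.trans (by gcongr)
            _ = _ := by ring
        have h7 : v x' + (t / (t' - t)) • (v x' - v x) - v p
            = (v x' - v p) + (t / (t' - t)) • (v x' - v x) := by abel
        have h8 : C' * η ≤ C' * B * η := by
          have : C' * 1 * η ≤ C' * B * η := by gcongr
          linarith
        rw [h7]
        refine (norm_add_le _ _).trans_lt ?_
        linarith
      · linarith [ht'.2, ht.1]
  refine ⟨η, hη0, ?_⟩
  rintro ⟨x, t⟩ ⟨hx, ht⟩ ⟨x', t'⟩ ⟨hx', ht'⟩ he
  rcases le_total t t' with hle | hle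
  · obtain ⟨h1, h2⟩ := key x hx x' hx' t ht t' ht' hle he
    exact Prod.ext h1 h2
  · obtain ⟨h1, h2⟩ := key x' hx' x hx t' ht' t ht hle he.symm
    exact Prod.ext h1.symm h2.symm

end IsOutward
end Outward

section LipschitzDomain

theorem IsLipschitzDomain.exists_isOutward {d : ℕ} {Ω : Set (EuclideanSpace ℝ (Fin d))}
    (h : IsLipschitzDomain Ω) {p : EuclideanSpace ℝ (Fin d)} (hp : p ∈ frontier Ω) :
    ∃ ν, ‖ν‖ = 1 ∧ IsOutward Ω p ν := by
  obtain ⟨ε, ν, g, L, hε, hν, -, hL, -, hΩC, hFC⟩ := h.2.2.2 p hp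
  refine ⟨ν, hν, ?_⟩
  have hνν : inner ℝ ν ν = (1 : ℝ) := by rw [real_inner_self_eq_norm_sq, hν, one_pow]
  have horth : ∀ z : EuclideanSpace ℝ (Fin d), z - inner ℝ ν z • ν ∈ (ℝ ∙ ν)ᗮ := fun z => by
    rw [Submodule.mem_orthogonal_singleton_iff_inner_right, inner_sub_right, inner_smul_right, hνν,
      mul_one, sub_self]
  have hin : ∀ z : EuclideanSpace ℝ (Fin d), |inner ℝ ν z| ≤ ‖z‖ := fun z => by
    have := abs_real_inner_le_norm ν z
    rwa [hν, one_mul] at this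
  have hproj : ∀ z : EuclideanSpace ℝ (Fin d), ‖z - inner ℝ ν z • ν‖ ≤ ‖z‖ := fun z => by
    have h1 := norm_sub_sq_real z (inner ℝ ν z • ν)
    rw [norm_smul, hν, mul_one, inner_smul_right, Real.norm_eq_abs, sq_abs, real_inner_comm ν z] at h1
    have h2 : ‖z - inner ℝ ν z • ν‖ ^ 2 ≤ ‖z‖ ^ 2 := by nlinarith [sq_nonneg (inner ℝ ν z : ℝ)]
    exact (sq_le_sq₀ (norm_nonneg _) (norm_nonneg _)).1 h2
  have hdec : ∀ q : EuclideanSpace ℝ (Fin d),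
      q = p + (q - p - inner ℝ ν (q - p) • ν) + inner ℝ ν (q - p) • ν := fun q => by abel
  have huniq : ∀ x' ∈ (ℝ ∙ ν)ᗮ, ∀ t : ℝ, inner ℝ ν (p + x' + t • ν - p) = t ∧
      p + x' + t • ν - p - t • ν = x' := fun x' hx' t => by
    rw [Submodule.mem_orthogonal_singleton_iff_inner_right] at hx'
    refine ⟨?_, by abel⟩
    have h1 : p + x' + t • ν - p = x' + t • ν := by abel
    rw [h1, inner_add_right, hx', inner_smul_right, hνν, mul_one, zero_add]
  have hcyl : ∀ q : EuclideanSpace ℝ (Fin d), ‖q - p‖ < ε → q ∈ LipCylinder p ν ε := fun q hq =>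
    ⟨_, horth (q - p), _, (hproj _).trans_lt hq, (hin _).trans_lt hq, hdec q⟩
  have hle : ∀ q ∈ closure Ω, ‖q - p‖ < ε →
      inner ℝ ν (q - p) ≤ g (q - p - inner ℝ ν (q - p) • ν) := by
    intro q hq hqp
    rw [closure_eq_self_union_frontier] at hq
    rcases hq with hq | hq
    · obtain ⟨x', hx', t, -, -, ht, rfl⟩ := hΩC.subset ⟨hq, hcyl q hqp⟩
      obtain ⟨h1, h2⟩ := huniq x' hx' t
      rw [h1, h2]
      exact ht.le
    · obtain ⟨x', hx', -, rfl⟩ := hFC.subset ⟨hq, hcyl q hqp⟩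
      obtain ⟨h1, h2⟩ := huniq x' hx' (g x')
      rw [h1, h2]
  have hL0 : (0 : ℝ) ≤ L := L.coe_nonneg
  set δ := min (ε / 4) (1 / (2 * (L + 1))) with hδ
  have hδ0 : 0 < δ := by positivity
  have hδε : δ ≤ ε / 4 := min_le_left _ _
  have hδL : δ * (L + 1) ≤ 1 / 2 := by
    have : δ ≤ 1 / (2 * ((L : ℝ) + 1)) := min_le_right _ _
    rw [le_div_iff₀ (by positivity)] at this
    linarith
  have hδ1 : δ ≤ 1 / 2 := by nlinarith
  refine ⟨δ, hδ0, fun q hq hqp w hw s hs0 hs => ?_⟩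
  have hqε : ‖q - p‖ < ε := by linarith
  have hw2 : ‖w‖ ≤ 2 := by
    have := norm_le_norm_add_norm_sub' w ν
    linarith
  have hq' : ‖q - s • w - p‖ < ε := by
    have h1 : q - s • w - p = (q - p) - s • w := by abel
    have h2 := norm_sub_le (q - p) (s • w)
    rw [norm_smul, Real.norm_of_nonneg hs0.le] at h2
    rw [h1]
    nlinarith
  have hsub : q - s • w - p = (q - p) - s • ν - s • (w - ν) := by rw [smul_sub]; abel
  have hinner : inner ℝ ν (q - s • w - p) = inner ℝ ν (q - p) - s - s * inner ℝ ν (w - ν) := by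
    rw [hsub, inner_sub_right, inner_sub_right, inner_smul_right, inner_smul_right, hνν, mul_one]
  have hdist : dist (q - p - inner ℝ ν (q - p) • ν)
      (q - s • w - p - inner ℝ ν (q - s • w - p) • ν) ≤ s * δ := by
    have h1 : (q - p - inner ℝ ν (q - p) • ν) - (q - s • w - p - inner ℝ ν (q - s • w - p) • ν)
        = s • ((w - ν) - inner ℝ ν (w - ν) • ν) := by
      rw [hinner, hsub]
      module
    rw [dist_eq_norm, h1, norm_smul, Real.norm_of_nonneg hs0.le]
    gcongr
    exact (hproj _).trans hw.le
  have hlip := hL.dist_le_mul (q - p - inner ℝ ν (q - p) • ν)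
    ⟨horth _, (hproj _).trans_lt hqε⟩ (q - s • w - p - inner ℝ ν (q - s • w - p) • ν)
    ⟨horth _, (hproj _).trans_lt hq'⟩
  rw [Real.dist_eq] at hlip
  have hlip' := (le_abs_self _).trans hlip
  have h4 := hle q hq hqε
  have h5 := (abs_le.1 (hin (w - ν))).1
  have h6 : (L : ℝ) * dist (q - p - inner ℝ ν (q - p) • ν)
      (q - s • w - p - inner ℝ ν (q - s • w - p) • ν) ≤ L * (s * δ) := by gcongr
  refine (hΩC.superset ⟨_, horth (q - s • w - p), inner ℝ ν (q - s • w - p),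
    (hproj _).trans_lt hq', (abs_lt.1 ((hin _).trans_lt hq')).1, ?_, hdec _⟩).1
  have h7 : inner ℝ ν (q - s • w - p) < inner ℝ ν (q - p) - (L : ℝ) * (s * δ) := by
    rw [hinner]
    nlinarith
  linarith

/-- A Lipschitz domain has a Lipschitz field of outward directions along its boundary. -/
theorem IsLipschitzDomain.exists_field {d : ℕ} {Ω : Set (EuclideanSpace ℝ (Fin d))}
    (h : IsLipschitzDomain Ω) :
    ∃ (v : EuclideanSpace ℝ (Fin d) → EuclideanSpace ℝ (Fin d)) (C : ℝ),
      (∀ x x', ‖v x - v x'‖ ≤ C * ‖x - x'‖) ∧ ∀ p ∈ frontier Ω, IsOutward Ω p (v p) := by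
  have hloc : ∀ p : frontier Ω, ∃ ν, ‖ν‖ = 1 ∧ ∃ r > 0, ∀ x ∈ ball p.1 r, IsOutward Ω x ν := fun p => by
    obtain ⟨ν, hν, ho⟩ := h.exists_isOutward p.2
    exact ⟨ν, hν, ho.exists_ball⟩
  choose ν hν r hr hball using hloc
  have hK : IsCompact (frontier Ω) :=
    h.2.2.1.isCompact_closure.of_isClosed_subset isClosed_frontier frontier_subset_closure
  obtain ⟨t, ht⟩ := hK.elim_finite_subcover (fun p : frontier Ω => ball p.1 (r p))
    (fun _ => isOpen_ball) fun x hx => mem_iUnion.2 ⟨⟨x, hx⟩, mem_ball_self (hr _)⟩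
  refine ⟨fun x => ∑ i ∈ t, max 0 (r i - ‖x - i.1‖) • ν i, t.card, fun x x' => ?_, fun p hp => ?_⟩
  · rw [← Finset.sum_sub_distrib, ← nsmul_eq_mul, ← Finset.sum_const]
    refine norm_sum_le_of_le t fun i _ => ?_
    rw [← sub_smul, norm_smul, hν, mul_one, Real.norm_eq_abs]
    refine (abs_max_sub_max_le_max _ _ _ _).trans ?_
    rw [sub_self, abs_zero, sub_sub_sub_cancel_left, abs_sub_comm]
    refine max_le (norm_nonneg _) ((abs_norm_sub_norm_le _ _).trans_eq ?_)
    rw [sub_sub_sub_cancel_right]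
  · refine IsOutward.sum_smul t (fun i _ => le_max_left _ _) (fun i _ hi => ?_) ?_
    · refine hball i p ?_
      rw [lt_max_iff] at hi
      rw [mem_ball, dist_eq_norm]
      linarith [hi.resolve_left (lt_irrefl _)]
    · obtain ⟨i, hi, hpi⟩ := mem_iUnion₂.1 (ht hp)
      rw [mem_ball, dist_eq_norm] at hpi
      exact ⟨i, hi, lt_max_of_lt_right (by linarith)⟩

end LipschitzDomain

theorem Set.InjOn.continuousOn_invFunOn {X Y : Type*} [TopologicalSpace X] [TopologicalSpace Y]
    [T2Space Y] [Nonempty X] {K : Set X} {f : X → Y} (hi : InjOn f K) (hK : IsCompact K)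
    (hf : ContinuousOn f K) : ContinuousOn (Function.invFunOn f K) (f '' K) := by
  rw [continuousOn_iff_isClosed]
  intro t ht
  refine ⟨f '' (K ∩ t),
    ((hK.inter_right ht).image_of_continuousOn (hf.mono inter_subset_left)).isClosed, ?_⟩
  ext y
  constructor
  · rintro ⟨hyt, x, hx, rfl⟩
    rw [mem_preimage, hi.leftInvOn_invFunOn hx] at hyt
    exact ⟨⟨x, ⟨hx, hyt⟩, rfl⟩, ⟨x, hx, rfl⟩⟩
  · rintro ⟨⟨x, ⟨hx, hxt⟩, rfl⟩, h⟩
    exact ⟨by rwa [mem_preimage, hi.leftInvOn_invFunOn hx], h⟩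

section Displacement
variable {E : Type*} [NormedAddCommGroup E] [InnerProductSpace ℝ E] [FiniteDimensional ℝ E]

/-- A homeomorphism from the closure of `Ω` onto the closed unit ball matches the boundaries, as
soon as no boundary point of `Ω` is interior to its closure. -/
theorem norm_eq_one_iff_mem_frontier {Ω : Set E} (hΩ : IsOpen Ω)
    (hb : Bornology.IsBounded Ω) (hinter : ∀ p ∈ frontier Ω, p ∉ interior (closure Ω)) {φ : E → E}
    (hφ : ContinuousOn φ (closure Ω)) (hφi : InjOn φ (closure Ω))
    (himg : φ '' closure Ω = closedBall 0 1) {x : E} (hx : x ∈ closure Ω) :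
    ‖φ x‖ = 1 ↔ x ∈ frontier Ω := by
  have hball : ∀ x ∈ closure Ω, ‖φ x‖ ≤ 1 := fun x hx => by
    simpa using himg.subset (mem_image_of_mem φ hx)
  constructor
  · intro h
    rw [hΩ.frontier_eq]
    refine ⟨hx, fun hxΩ => h.not_lt ?_⟩
    have h1 : φ '' Ω ⊆ interior (closedBall 0 1) :=
      interior_maximal ((image_mono subset_closure).trans himg.subset)
        (isOpen_image_of_injOn hΩ (hφ.mono subset_closure) (hφi.mono subset_closure))
    rw [interior_closedBall _ one_ne_zero] at h1
    simpa using h1 (mem_image_of_mem φ hxΩ)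
  · intro h
    refine (hball x hx).antisymm (not_lt.1 fun hlt => hinter x h ?_)
    have hc := hφi.continuousOn_invFunOn hb.isCompact_closure hφ
    rw [himg] at hc
    have hi : InjOn (Function.invFunOn φ (closure Ω)) (closedBall 0 1) := by
      rw [← himg]
      exact Function.invFunOn_injOn_image φ _
    have ho := isOpen_image_of_injOn isOpen_ball (hc.mono ball_subset_closedBall)
      (hi.mono ball_subset_closedBall)
    refine interior_maximal ?_ ho ⟨φ x, by simpa using hlt, hφi.leftInvOn_invFunOn hx⟩
    rintro _ ⟨u, hu, rfl⟩
    exact Function.invFunOn_mem (himg.superset (ball_subset_closedBall hu))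

/-- Displacing the boundary along a Lipschitz field of outward directions, and then applying a
`C¹` map which is injective on the boundary and nondegenerate there, is injective for small
displacements. -/
theorem exists_injOn_displacement {Ω V : Set E} (hΩ : IsOpen Ω) (hb : Bornology.IsBounded Ω)
    {v : E → E} {C : ℝ} (hv : ∀ x x', ‖v x - v x'‖ ≤ C * ‖x - x'‖)
    (ho : ∀ p ∈ frontier Ω, IsOutward Ω p (v p)) (hV : IsOpen V) (hΩV : frontier Ω ⊆ V) {y : E → E}
    (hy : ContDiffOn ℝ 1 y V) (hyi : InjOn y (frontier Ω))
    (hdet : ∀ x ∈ frontier Ω, (fderiv ℝ y x).det ≠ 0) :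
    ∃ ε > 0, ContinuousOn (fun z : E × ℝ => y (z.1 + z.2 • v z.1)) (frontier Ω ×ˢ Icc (-ε) ε) ∧
      InjOn (fun z : E × ℝ => y (z.1 + z.2 • v z.1)) (frontier Ω ×ˢ Icc (-ε) ε) := by
  have hvc : Continuous v := (LipschitzWith.of_dist_le_mul (K := C.toNNReal) fun x x' => by
    rw [dist_eq_norm, dist_eq_norm]
    exact (hv x x').trans (mul_le_mul_of_nonneg_right (Real.le_coe_toNNReal C)
      (norm_nonneg _))).continuous
  set m : E × ℝ → E := fun z => z.1 + z.2 • v z.1 with hm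
  have hmc : Continuous m := by fun_prop
  have hcpt : IsCompact (frontier Ω) :=
    hb.isCompact_closure.of_isClosed_subset isClosed_frontier frontier_subset_closure
  have : CompactSpace (frontier Ω) := isCompact_iff_compactSpace.1 hcpt
  set i : frontier Ω × ℝ → E × ℝ := fun z => (z.1, z.2) with hi
  have hic : Continuous i := by fun_prop
  have hm0 : ∀ x, m (x, 0) = x := fun x => by simp [hm]
  have hcont : ∀ z, m z ∈ V → ContinuousAt (fun z => y (m z)) z := fun z hz =>
    ContinuousAt.comp (hy.continuousOn.continuousAt (hV.mem_nhds hz)) hmc.continuousAt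
  have hloc : ∀ z ∈ (univ ×ˢ {0} : Set (frontier Ω × ℝ)),
      ∃ u ∈ 𝓝 z, InjOn (fun z => y (m (i z))) u := by
    rintro ⟨⟨p, hp⟩, t⟩ ⟨-, rfl⟩
    obtain ⟨η, hη, hinj⟩ := (ho p hp).exists_injOn hΩ hv
    have hst : HasStrictFDerivAt y
        ((fderiv ℝ y p).toContinuousLinearEquivOfDetNeZero (hdet p hp) : E →L[ℝ] E) p := by
      rw [ContinuousLinearMap.coe_toContinuousLinearEquivOfDetNeZero]
      exact (hy.contDiffAt (hV.mem_nhds (hΩV hp))).hasStrictFDerivAt one_ne_zero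
    obtain ⟨W, hW, hyW⟩ : ∃ W ∈ 𝓝 p, InjOn y W :=
      ⟨_, (hst.toOpenPartialHomeomorph y).open_source.mem_nhds
        hst.mem_toOpenPartialHomeomorph_source, (hst.toOpenPartialHomeomorph y).injOn⟩
    have h1 : i ⁻¹' (m ⁻¹' W) ∈ 𝓝 ((⟨p, hp⟩, 0) : frontier Ω × ℝ) := by
      refine (hmc.comp hic).continuousAt.preimage_mem_nhds ?_
      rw [Function.comp_apply, hm0]
      exact hW
    have h2 : i ⁻¹' (ball p η ×ˢ Ioo (-η) η) ∈ 𝓝 ((⟨p, hp⟩, 0) : frontier Ω × ℝ) :=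
      hic.continuousAt.preimage_mem_nhds
        ((isOpen_ball.prod isOpen_Ioo).mem_nhds ⟨mem_ball_self hη, neg_lt_zero.2 hη, hη⟩)
    refine ⟨_, inter_mem h1 h2, ?_⟩
    rintro z ⟨hz1, hz2⟩ z' ⟨hz1', hz2'⟩ he
    have h3 := hinj (x₁ := i z) (x₂ := i z') ⟨⟨z.1.2, hz2.1⟩, hz2.2⟩ ⟨⟨z'.1.2, hz2'.1⟩, hz2'.2⟩
      (hyW hz1 hz1' he)
    rw [hi, Prod.mk.injEq] at h3
    exact Prod.ext (Subtype.ext h3.1) h3.2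
  have hinj0 : InjOn (fun z => y (m (i z))) (univ ×ˢ {0} : Set (frontier Ω × ℝ)) := by
    rintro ⟨x, t⟩ ⟨-, rfl⟩ ⟨x', t'⟩ ⟨-, rfl⟩ he
    have h1 : y x = y x' := by simpa [hi, hm] using he
    rw [Subtype.ext (hyi x.2 x'.2 h1)]
  obtain ⟨T, hT, hTi⟩ := hinj0.exists_mem_nhdsSet (isCompact_univ.prod isCompact_singleton)
    (by
      rintro ⟨x, t⟩ ⟨-, rfl⟩
      exact (hcont (i (x, 0)) (by rw [hi, hm0]; exact hΩV x.2)).comp hic.continuousAt) hloc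
  have hTV : i ⁻¹' (m ⁻¹' V) ∈ 𝓝ˢ (univ ×ˢ {0} : Set (frontier Ω × ℝ)) := by
    refine (hV.preimage (hmc.comp hic)).mem_nhdsSet.2 ?_
    rintro ⟨x, t⟩ ⟨-, rfl⟩
    simpa [hi, hm] using hΩV x.2
  have hboth := inter_mem hT hTV
  rw [isCompact_univ.nhdsSet_prod_eq isCompact_singleton, nhdsSet_univ, nhdsSet_singleton,
    mem_prod_iff] at hboth
  obtain ⟨u, hu, w, hw, huw⟩ := hboth
  rw [mem_top] at hu
  subst hu
  obtain ⟨ε, hε, hεw⟩ := nhds_basis_closedBall.mem_iff.1 hw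
  rw [Real.closedBall_eq_Icc, zero_sub, zero_add] at hεw
  refine ⟨ε, hε, fun z hz => ?_, ?_⟩
  · exact (hcont z (huw (a := (⟨z.1, hz.1⟩, z.2)) ⟨mem_univ _, hεw hz.2⟩).2).continuousWithinAt
  · intro z hz z' hz' he
    have h1 := hTi (x₁ := (⟨z.1, hz.1⟩, z.2)) (x₂ := (⟨z'.1, hz'.1⟩, z'.2))
      (huw ⟨mem_univ _, hεw hz.2⟩).1 (huw ⟨mem_univ _, hεw hz'.2⟩).1 he
    rw [Prod.mk.injEq, Subtype.mk.injEq] at h1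
    exact Prod.ext h1.1 h1.2

theorem exists_extension_of_one_lt_rank (hd : 1 < Module.rank ℝ E) {Ω V : Set E} (hΩ : IsOpen Ω)
    (hb : Bornology.IsBounded Ω)
    {v : E → E} {C : ℝ} (hv : ∀ x x', ‖v x - v x'‖ ≤ C * ‖x - x'‖)
    (ho : ∀ p ∈ frontier Ω, IsOutward Ω p (v p)) {φ : E → E}
    (hφ : ContinuousOn φ (closure Ω)) (hφi : InjOn φ (closure Ω))
    (himg : φ '' closure Ω = closedBall 0 1) (hV : IsOpen V) (hΩV : frontier Ω ⊆ V) {y : E → E}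
    (hy : ContDiffOn ℝ 1 y V) (hyi : InjOn y (frontier Ω))
    (hdet : ∀ x ∈ frontier Ω, (fderiv ℝ y x).det ≠ 0) :
    ∃ h : E → E, ContinuousOn h (closure Ω) ∧ InjOn h (closure Ω) ∧
      ∀ x ∈ frontier Ω, h x = y x := by
  have : Nontrivial E := rank_pos_iff_nontrivial.1 (zero_lt_one.trans hd)
  obtain ⟨ε, hε, hFc, hFi⟩ := exists_injOn_displacement hΩ hb hv ho hV hΩV hy hyi hdet
  have hbd : ∀ x ∈ closure Ω, (‖φ x‖ = 1 ↔ x ∈ frontier Ω) := fun x hx =>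
    norm_eq_one_iff_mem_frontier hΩ hb (fun p hp => (ho p hp).notMem_interior_closure hΩ hp)
      hφ hφi himg hx
  set a := Function.invFunOn φ (closure Ω) with ha
  have hac := hφi.continuousOn_invFunOn hb.isCompact_closure hφ
  rw [himg, ← ha] at hac
  have hSB : sphere (0 : E) 1 ⊆ closedBall 0 1 := sphere_subset_closedBall
  have haS : MapsTo a (sphere 0 1) (frontier Ω) := fun u hu => by
    have h1 := himg.superset (hSB hu)
    refine (hbd _ (Function.invFunOn_mem h1)).1 ?_
    rw [Function.invFunOn_eq h1]
    simpa using hu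
  have hai : InjOn a (closedBall 0 1) := by
    rw [← himg]
    exact Function.invFunOn_injOn_image φ _
  set q : E × ℝ → E × ℝ := fun z => (a z.1, z.2) with hq
  have hqc : ContinuousOn q (sphere 0 1 ×ˢ Icc (-ε) ε) :=
    ((hac.mono hSB).comp continuousOn_fst fun z hz => hz.1).prodMk continuousOn_snd
  have hqm : MapsTo q (sphere 0 1 ×ˢ Icc (-ε) ε) (frontier Ω ×ˢ Icc (-ε) ε) := fun z hz =>
    ⟨haS hz.1, hz.2⟩
  have hqi : InjOn q (sphere 0 1 ×ˢ Icc (-ε) ε) := fun z hz z' hz' he =>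
    Prod.ext (hai (hSB hz.1) (hSB hz'.1) (Prod.ext_iff.1 he).1) (Prod.ext_iff.1 he).2
  obtain ⟨c, τ, hc, hcf⟩ := exists_isCollar hd hε (hFc.comp hqc hqm) (hFi.comp hqi hqm)
  obtain ⟨j, hjc, hji, hj⟩ := hc.exists_extension
  refine ⟨j ∘ φ, hjc.comp_continuousOn hφ, hji.comp_injOn hφi, fun x hx => ?_⟩
  have hxc := frontier_subset_closure hx
  have h1 := (hbd x hxc).2 hx
  rw [Function.comp_apply, hj _ h1, hcf _ h1]
  simp only [Function.comp_apply, hq, zero_smul, add_zero]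
  rw [ha, hφi.leftInvOn_invFunOn hxc]

theorem exists_extension_of_finrank_eq_one (hd : Module.finrank ℝ E = 1) {Ω : Set E} (hΩ : IsOpen Ω)
    (hb : Bornology.IsBounded Ω) (hinter : ∀ p ∈ frontier Ω, p ∉ interior (closure Ω)) {φ : E → E}
    (hφ : ContinuousOn φ (closure Ω)) (hφi : InjOn φ (closure Ω))
    (himg : φ '' closure Ω = closedBall 0 1) {y : E → E} (hyi : InjOn y (frontier Ω)) :
    ∃ h : E → E, ContinuousOn h (closure Ω) ∧ InjOn h (closure Ω) ∧
      ∀ x ∈ frontier Ω, h x = y x := by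
  have hbd : ∀ x ∈ closure Ω, (‖φ x‖ = 1 ↔ x ∈ frontier Ω) := fun x hx =>
    norm_eq_one_iff_mem_frontier hΩ hb hinter hφ hφi himg hx
  have : Nontrivial E := Module.nontrivial_of_finrank_pos (R := ℝ) (by omega)
  obtain ⟨e, he⟩ := exists_norm_eq E zero_le_one
  have hspan : ∀ z : E, ∃ t : ℝ, t • e = z :=
    (finrank_eq_one_iff_of_nonzero' e (by rintro rfl; simp at he)).1 hd
  have hee : inner ℝ e e = (1 : ℝ) := by rw [real_inner_self_eq_norm_sq, he, one_pow]
  obtain ⟨p, hp, hpe⟩ := himg.superset (show e ∈ closedBall 0 1 by simp [he])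
  obtain ⟨p', hp', hpe'⟩ := himg.superset (show -e ∈ closedBall 0 1 by simp [he])
  have hpf : p ∈ frontier Ω := (hbd p hp).1 (by rw [hpe, he])
  have hpf' : p' ∈ frontier Ω := (hbd p' hp').1 (by rw [hpe', norm_neg, he])
  have hne : y p - y p' ≠ 0 := fun h0 => by
    have h1 := hyi hpf hpf' (sub_eq_zero.1 h0)
    rw [h1, hpe', neg_eq_iff_add_eq_zero, ← two_smul ℝ,
      smul_eq_zero_iff_right two_ne_zero] at hpe
    simp [hpe] at he
  set A : E → E := fun z => (2⁻¹ : ℝ) • (y p + y p') + (2⁻¹ * inner ℝ e z : ℝ) • (y p - y p') with hA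
  have hAc : Continuous A := by fun_prop
  have hAi : Function.Injective A := fun z z' h => by
    obtain ⟨t, rfl⟩ := hspan z
    obtain ⟨t', rfl⟩ := hspan z'
    have h1 := smul_left_injective ℝ hne (add_left_cancel h)
    simp only [inner_smul_right, hee, mul_one] at h1
    rw [mul_left_cancel₀ (by norm_num) h1]
  refine ⟨A ∘ φ, hAc.comp_continuousOn hφ, hAi.comp_injOn hφi, fun x hx => ?_⟩
  have hxc := frontier_subset_closure hx
  have h1 := (hbd x hxc).2 hx
  obtain ⟨t, ht⟩ := hspan (φ x)
  rw [← ht, norm_smul, he, mul_one, Real.norm_eq_abs] at h1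
  rcases eq_or_eq_neg_of_abs_eq h1 with rfl | rfl
  · rw [one_smul] at ht
    obtain rfl := hφi hp hxc (hpe.trans ht)
    simp only [Function.comp_apply, hA, hpe, hee]
    module
  · rw [neg_smul, one_smul] at ht
    obtain rfl := hφi hp' hxc (hpe'.trans ht)
    simp only [Function.comp_apply, hA, hpe', inner_neg_right, hee]
    module

end Displacement

end

/-- Theorem A.7: on a bounded Lipschitz domain `Ω` with `cl(Ω)` homeomorphic to the
closed unit ball, a `C¹` map `y` (defined on an open neighborhood of `cl(Ω)`) which is
injective on `∂Ω` with `det Dy ≠ 0` on `∂Ω` admits a homeomorphic extension of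
`y|_{∂Ω}` to `cl(Ω)`. -/
theorem homeomorphic_extension_of_C1_boundary_injective {d : ℕ}
    (Ω : Set (EuclideanSpace ℝ (Fin d))) (hΩ : IsLipschitzDomain Ω)
    (hball : ∃ φ : EuclideanSpace ℝ (Fin d) → EuclideanSpace ℝ (Fin d),
      ContinuousOn φ (closure Ω) ∧ Set.InjOn φ (closure Ω) ∧
      φ '' (closure Ω) = Metric.closedBall (0 : EuclideanSpace ℝ (Fin d)) 1)
    (V : Set (EuclideanSpace ℝ (Fin d))) (hV : IsOpen V) (hΩV : closure Ω ⊆ V)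
    (y : EuclideanSpace ℝ (Fin d) → EuclideanSpace ℝ (Fin d))
    (hy : ContDiffOn ℝ 1 y V)
    (hyi : Set.InjOn y (frontier Ω))
    (hdet : ∀ x ∈ frontier Ω, (fderiv ℝ y x).det ≠ 0) :
    ∃ h : EuclideanSpace ℝ (Fin d) → EuclideanSpace ℝ (Fin d),
      ContinuousOn h (closure Ω) ∧ Set.InjOn h (closure Ω) ∧
      ∀ x ∈ frontier Ω, h x = y x := by
  obtain ⟨φ, hφ, hφi, himg⟩ := hball
  obtain ⟨v, C, hv, ho⟩ := hΩ.exists_field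
  rcases lt_trichotomy d 1 with hd | rfl | hd
  · obtain rfl : d = 0 := by omega
    exact ⟨id, continuousOn_id, Set.injOn_id _, fun x _ => Subsingleton.elim _ _⟩
  · exact exists_extension_of_finrank_eq_one finrank_euclideanSpace_fin hΩ.1 hΩ.2.2.1
      (fun p hp => (ho p hp).notMem_interior_closure hΩ.1 hp) hφ hφi himg hyi
  · refine exists_extension_of_one_lt_rank ?_ hΩ.1 hΩ.2.2.1 hv ho hφ hφi himg hV
      (frontier_subset_closure.trans hΩV) hy hyi hdet
    rw [← Module.finrank_eq_rank, finrank_euclideanSpace_fin]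
    exact_mod_cast hd
end

section
/- Let d ≥ 2, let ν ∈ ℝ^d be a unit vector and P := ν^⊥ its orthogonal complement. Let ε > 0 and let g : {x' ∈ P : |x'| < ε} → (−ε, ε) be a Lipschitz function with g(0) = 0. Let V ⊆ ℝ^d be an open set containing the graph points {x' + g(x')ν : x' ∈ P, |x'| < ε}, and let y : V → ℝ^d be continuously differentiable with Dy(0) invertible. Define ŷ on the open cylinder {x' + tν : x' ∈ P, |x'| < ε, t ∈ (−ε, ε)} by ŷ(x' + tν) := y(x' + g(x')ν) + (t − g(x'))·(Dy(0)ν). Then there exist r ∈ (0, ε] and constants 0 < c ≤ L such that for all a, b in the cylinder {x' + tν : x' ∈ P, |x'| < r, |t| < r} one has c·|a − b| ≤ |ŷ(a) − ŷ(b)| ≤ L·|a − b|; in particular, ŷ is injective and bi-Lipschitz on this smaller cylinder, and ŷ agrees with y at all graph points x' + g(x')ν contained in it. -/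
open scoped RealInnerProductSpace

/-- The graph map `x' ↦ x' + g(x')ν` of a `K`-Lipschitz function is `(1 + K)`-Lipschitz. -/
theorem LipschitzOnWith.norm_graph_sub_le {E : Type*} [NormedAddCommGroup E] [NormedSpace ℝ E]
    {g : E → ℝ} {K : NNReal} {s : Set E} (hg : LipschitzOnWith K g s) {ν : E} (hν : ‖ν‖ = 1)
    {u v : E} (hu : u ∈ s) (hv : v ∈ s) :
    ‖(u + g u • ν) - (v + g v • ν)‖ ≤ (1 + K) * ‖u - v‖ := by
  have h1 : (u + g u • ν) - (v + g v • ν) = (u - v) + (g u - g v) • ν := by module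
  have h2 := hg.norm_sub_le hu hv
  calc ‖(u + g u • ν) - (v + g v • ν)‖ ≤ ‖u - v‖ + ‖(g u - g v) • ν‖ := by
        rw [h1]; exact norm_add_le _ _
    _ ≤ (1 + K) * ‖u - v‖ := by
        rw [norm_smul, hν]; linarith

section OrthogonalComponent

variable {E : Type*} [NormedAddCommGroup E] [InnerProductSpace ℝ E] {ν : E}

theorem sub_inner_smul_mem_orthogonal (hν : ‖ν‖ = 1) (x : E) :
    x - ⟪x, ν⟫ • ν ∈ (ℝ ∙ ν)ᗮ := by
  rw [Submodule.mem_orthogonal_singleton_iff_inner_left, inner_sub_left, real_inner_smul_left,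
    real_inner_self_eq_norm_sq, hν]
  ring

theorem norm_sub_inner_smul_le (hν : ‖ν‖ = 1) (x : E) : ‖x - ⟪x, ν⟫ • ν‖ ≤ ‖x‖ := by
  have h : ‖x - ⟪x, ν⟫ • ν‖ ^ 2 = ‖x‖ ^ 2 - ⟪x, ν⟫ ^ 2 := by
    rw [norm_sub_sq_real, real_inner_smul_right, norm_smul, hν, Real.norm_eq_abs, mul_one, sq_abs]
    ring
  exact le_of_sq_le_sq (by nlinarith [sq_nonneg ⟪x, ν⟫]) (norm_nonneg x)

end OrthogonalComponent

/-- An invertible continuous linear map is bounded below. -/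
theorem ContinuousLinearMap.exists_norm_le_mul_of_isUnit {E : Type*} [NormedAddCommGroup E]
    [NormedSpace ℝ E] {A : E →L[ℝ] E} (hA : IsUnit A) :
    ∃ K : ℝ, 0 < K ∧ ∀ x, ‖x‖ ≤ K * ‖A x‖ := by
  obtain ⟨u, rfl⟩ := hA
  refine ⟨‖(↑u⁻¹ : E →L[ℝ] E)‖ + 1, by positivity, fun x => ?_⟩
  have h : (↑u⁻¹ : E →L[ℝ] E) ((u : E →L[ℝ] E) x) = x := by
    rw [← mul_apply_eq_comp, Units.inv_mul, one_apply_eq_self]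
  have h2 := (↑u⁻¹ : E →L[ℝ] E).le_opNorm ((u : E →L[ℝ] E) x)
  rw [h] at h2
  linarith [norm_nonneg ((u : E →L[ℝ] E) x)]

/-- The local bi-Lipschitz extension of a boundary map (from the proof of Theorem A.7):
`ŷ(x' + tν) := y(x' + g(x')ν) + (t − g(x'))·(Dy(0)ν)` is bi-Lipschitz on some smaller
cylinder `{x' + tν : |x'| < r, |t| < r}` and agrees with `y` at graph points there. -/
theorem local_biLipschitz_extension {d : ℕ} (hd : 2 ≤ d)
    (ν : EuclideanSpace ℝ (Fin d)) (hν : ‖ν‖ = 1)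
    (ε : ℝ) (hε : 0 < ε)
    (g : EuclideanSpace ℝ (Fin d) → ℝ) (Lg : NNReal)
    (hLip : LipschitzOnWith Lg g {x' | x' ∈ (ℝ ∙ ν)ᗮ ∧ ‖x'‖ < ε})
    (hg0 : g 0 = 0)
    (hgr : ∀ x' ∈ (ℝ ∙ ν)ᗮ, ‖x'‖ < ε → |g x'| < ε)
    (V : Set (EuclideanSpace ℝ (Fin d))) (hV : IsOpen V)
    (hgraph : {q | ∃ x' ∈ (ℝ ∙ ν)ᗮ, ‖x'‖ < ε ∧ q = x' + g x' • ν} ⊆ V)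
    (y : EuclideanSpace ℝ (Fin d) → EuclideanSpace ℝ (Fin d))
    (hy : ContDiffOn ℝ 1 y V)
    (hinv : IsUnit (fderiv ℝ y 0))
    (yhat : EuclideanSpace ℝ (Fin d) → EuclideanSpace ℝ (Fin d))
    (hyhat : ∀ x : EuclideanSpace ℝ (Fin d), yhat x =
      y ((x - ⟪x, ν⟫ • ν) + g (x - ⟪x, ν⟫ • ν) • ν) +
        (⟪x, ν⟫ - g (x - ⟪x, ν⟫ • ν)) • (fderiv ℝ y 0 ν)) :
    ∃ r : ℝ, 0 < r ∧ r ≤ ε ∧ ∃ c L : ℝ, 0 < c ∧ c ≤ L ∧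
      (∀ a ∈ {x : EuclideanSpace ℝ (Fin d) | ‖x - ⟪x, ν⟫ • ν‖ < r ∧ |⟪x, ν⟫| < r},
       ∀ b ∈ {x : EuclideanSpace ℝ (Fin d) | ‖x - ⟪x, ν⟫ • ν‖ < r ∧ |⟪x, ν⟫| < r},
        c * ‖a - b‖ ≤ ‖yhat a - yhat b‖ ∧ ‖yhat a - yhat b‖ ≤ L * ‖a - b‖) ∧
      (∀ x' ∈ (ℝ ∙ ν)ᗮ, ‖x'‖ < ε →
        (x' + g x' • ν) ∈ {x : EuclideanSpace ℝ (Fin d) |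
            ‖x - ⟪x, ν⟫ • ν‖ < r ∧ |⟪x, ν⟫| < r} →
        yhat (x' + g x' • ν) = y (x' + g x' • ν)) := by
  set A := fderiv ℝ y 0
  have h0V : (0 : EuclideanSpace ℝ (Fin d)) ∈ V :=
    hgraph ⟨0, zero_mem _, by simpa using hε, by simp [hg0]⟩
  have hstrict : HasStrictFDerivAt y A 0 :=
    (hy.contDiffAt (hV.mem_nhds h0V)).hasStrictFDerivAt one_ne_zero
  obtain ⟨K, hK, hlow⟩ := ContinuousLinearMap.exists_norm_le_mul_of_isUnit hinv
  set M : ℝ := 1 + Lg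
  have hMpos : 0 < M := by positivity
  have hη : 0 < 1 / (2 * K * M) := by positivity
  obtain ⟨s, hs, happ⟩ := hstrict.approximates_deriv_on_nhds
    (c := ⟨1 / (2 * K * M), hη.le⟩) (Or.inr hη)
  obtain ⟨δ, hδ, hball⟩ := Metric.mem_nhds_iff.1 hs
  refine ⟨min ε (δ / M), lt_min hε (by positivity), min_le_left _ _,
    1 / (2 * K), ‖A‖ + 1 / (2 * K), by positivity, by linarith [norm_nonneg A], ?_, ?_⟩
  · have hdom : ∀ x : EuclideanSpace ℝ (Fin d), ‖x - ⟪x, ν⟫ • ν‖ < min ε (δ / M) →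
        x - ⟪x, ν⟫ • ν ∈ {x' | x' ∈ (ℝ ∙ ν)ᗮ ∧ ‖x'‖ < ε} := fun x hx =>
      ⟨sub_inner_smul_mem_orthogonal hν x, hx.trans_le (min_le_left _ _)⟩
    have hmem : ∀ x : EuclideanSpace ℝ (Fin d), ‖x - ⟪x, ν⟫ • ν‖ < min ε (δ / M) →
        (x - ⟪x, ν⟫ • ν) + g (x - ⟪x, ν⟫ • ν) • ν ∈ s := by
      intro x hx
      apply hball
      rw [mem_ball_zero_iff]
      have h := hLip.norm_graph_sub_le hν (hdom x hx)
        (show (0 : EuclideanSpace ℝ (Fin d)) ∈ _ from ⟨zero_mem _, by simpa using hε⟩)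
      rw [hg0, zero_smul, add_zero, sub_zero, sub_zero] at h
      have h2 := (lt_div_iff₀' hMpos).1 (hx.trans_le (min_le_right _ _))
      exact h.trans_lt h2
    rintro a ⟨ha, -⟩ b ⟨hb, -⟩
    have herr : ‖(yhat a - yhat b) - A (a - b)‖ ≤ 1 / (2 * K) * ‖a - b‖ := by
      have hgraph_le := hLip.norm_graph_sub_le hν (hdom a ha) (hdom b hb)
      have hproj : ‖(a - ⟪a, ν⟫ • ν) - (b - ⟪b, ν⟫ • ν)‖ ≤ ‖a - b‖ := by
        have h := norm_sub_inner_smul_le hν (a - b)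
        rwa [inner_sub_left, sub_smul, sub_sub_sub_comm] at h
      have happ' := happ _ (hmem a ha) _ (hmem b hb)
      rw [hyhat, hyhat]
      generalize g (a - ⟪a, ν⟫ • ν) = ga at *
      generalize g (b - ⟪b, ν⟫ • ν) = gb at *
      calc _ = ‖y (a - ⟪a, ν⟫ • ν + ga • ν) - y (b - ⟪b, ν⟫ • ν + gb • ν) -
              A ((a - ⟪a, ν⟫ • ν + ga • ν) - (b - ⟪b, ν⟫ • ν + gb • ν))‖ := by
            congr 1
            simp only [map_sub, map_add, map_smul]
            module
        _ ≤ 1 / (2 * K * M) * (M * ‖a - b‖) := by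
            refine happ'.trans (mul_le_mul_of_nonneg_left ?_ hη.le)
            exact hgraph_le.trans (mul_le_mul_of_nonneg_left hproj hMpos.le)
        _ = 1 / (2 * K) * ‖a - b‖ := by field_simp
    constructor
    · have h1 : 1 / K * ‖a - b‖ ≤ ‖A (a - b)‖ := by
        rw [one_div, inv_mul_le_iff₀ hK]
        exact hlow _
      have h2 := norm_sub_norm_le (A (a - b)) (yhat a - yhat b)
      rw [norm_sub_rev (A (a - b))] at h2
      have h3 : 1 / K * ‖a - b‖ = 1 / (2 * K) * ‖a - b‖ + 1 / (2 * K) * ‖a - b‖ := by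
        field_simp
        ring
      linarith
    · have h2 := norm_sub_norm_le (yhat a - yhat b) (A (a - b))
      linarith [A.le_opNorm (a - b)]
  · intro x' hx' _ _
    have hin : ⟪x' + g x' • ν, ν⟫ = g x' := by
      rw [inner_add_left, real_inner_smul_left, real_inner_self_eq_norm_sq, hν,
        Submodule.mem_orthogonal_singleton_iff_inner_left.1 hx']
      ring
    rw [hyhat, hin, add_sub_cancel_right, sub_self, zero_smul, add_zero]
end
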